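/- arXiv:1112.3257 — 7 statements merged into one kernel-verified Lean document; each statement's English description precedes it below -/
import Mathlib

section
/- For two homogeneous hidden Markov models θ₁, θ₀ of length N ≥ 2 with all parameters strictly positive, the Kullback–Leibler distance between their joint pmfs admits the closed form D_N(θ₁‖θ₀) = k_∅ + Σ_{i=0}^{N-2} ( μ_{θ₁} ⬝ π_{θ₁}^i ⬝ k ), where μ_{θ₁} is viewed as a row vector, π_{θ₁} as a square matrix indexed by 𝒮, k as a column vector, and μ_{θ₁} ⬝ π_{θ₁}^i ⬝ k = Σ_{r,s} μ_{θ₁}(r) (π_{θ₁}^i)(r,s) k(s). -/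
/-!
STATEMENT 8: Closed form for the KLD between two homogeneous hidden Markov models of length N.
-/

namespace HMM

variable {𝒮 𝒳 : Type} [Fintype 𝒮] [Fintype 𝒳]

/-- The joint pmf `p_θ(x, s)` of a homogeneous hidden Markov model of length `N`:
`p_θ(x,s) = μ_θ(s 0) e_θ(s 0, x 0) · ∏_{i=1}^{N-1} π_θ(s(i-1), s i) e_θ(s i, x i)`. -/
noncomputable def pmf (N : ℕ) (hN : 2 ≤ N) (μ : 𝒮 → ℝ) (π : 𝒮 → 𝒮 → ℝ) (e : 𝒮 → 𝒳 → ℝ)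
    (x : Fin N → 𝒳) (s : Fin N → 𝒮) : ℝ :=
  μ (s ⟨0, by omega⟩) * e (s ⟨0, by omega⟩) (x ⟨0, by omega⟩) *
    ∏ i : Fin N,
      if i.val = 0 then 1
      else π (s ⟨i.val - 1, Nat.lt_of_le_of_lt (Nat.sub_le _ _) i.isLt⟩) (s i) * e (s i) (x i)

/-- The Kullback–Leibler distance `D_N(θ₁ ‖ θ₀)` between the joint pmfs of two homogeneous
hidden Markov models of length `N`. -/
noncomputable def KLD (N : ℕ) (hN : 2 ≤ N) (μ1 μ0 : 𝒮 → ℝ) (π1 π0 : 𝒮 → 𝒮 → ℝ)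
    (e1 e0 : 𝒮 → 𝒳 → ℝ) : ℝ :=
  ∑ x : Fin N → 𝒳, ∑ s : Fin N → 𝒮,
    pmf N hN μ1 π1 e1 x s * Real.log (pmf N hN μ1 π1 e1 x s / pmf N hN μ0 π0 e0 x s)

/-- `k(r) = Σ_{s,x} π₁(r,s) e₁(s,x) log( (π₁(r,s) e₁(s,x)) / (π₀(r,s) e₀(s,x)) )`. -/
noncomputable def kfun (π1 π0 : 𝒮 → 𝒮 → ℝ) (e1 e0 : 𝒮 → 𝒳 → ℝ) (r : 𝒮) : ℝ :=
  ∑ s : 𝒮, ∑ x : 𝒳, π1 r s * e1 s x * Real.log ((π1 r s * e1 s x) / (π0 r s * e0 s x))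

/-- `k_∅ = Σ_{s,x} μ₁(s) e₁(s,x) log( (μ₁(s) e₁(s,x)) / (μ₀(s) e₀(s,x)) )`. -/
noncomputable def kinit (μ1 μ0 : 𝒮 → ℝ) (e1 e0 : 𝒮 → 𝒳 → ℝ) : ℝ :=
  ∑ s : 𝒮, ∑ x : 𝒳, μ1 s * e1 s x * Real.log ((μ1 s * e1 s x) / (μ0 s * e0 s x))

end HMM

namespace HMM

variable {𝒮 𝒳 : Type}

/-- The joint pmf of a hidden Markov model with `n` transitions, written as a product over the
transitions. -/
noncomputable def pathWeight (n : ℕ) (μ : 𝒮 → ℝ) (π : 𝒮 → 𝒮 → ℝ) (e : 𝒮 → 𝒳 → ℝ)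
    (x : Fin (n + 1) → 𝒳) (s : Fin (n + 1) → 𝒮) : ℝ :=
  μ (s 0) * e (s 0) (x 0) *
    ∏ i : Fin n, π (s i.castSucc) (s i.succ) * e (s i.succ) (x i.succ)

theorem pmf_eq_pathWeight (n : ℕ) (hn : 2 ≤ n + 1) (μ : 𝒮 → ℝ) (π : 𝒮 → 𝒮 → ℝ) (e : 𝒮 → 𝒳 → ℝ)
    (x : Fin (n + 1) → 𝒳) (s : Fin (n + 1) → 𝒮) :
    pmf (n + 1) hn μ π e x s = pathWeight n μ π e x s := by
  unfold pmf pathWeight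
  rw [Fin.prod_univ_succ]
  simp only [Fin.val_zero, if_true, one_mul, Fin.val_succ, Nat.add_one_ne_zero, if_false]
  rfl

theorem pathWeight_pos {μ : 𝒮 → ℝ} {π : 𝒮 → 𝒮 → ℝ} {e : 𝒮 → 𝒳 → ℝ} (hμ : ∀ s, 0 < μ s)
    (hπ : ∀ r s, 0 < π r s) (he : ∀ s x, 0 < e s x) (n : ℕ)
    (x : Fin (n + 1) → 𝒳) (s : Fin (n + 1) → 𝒮) : 0 < pathWeight n μ π e x s :=
  mul_pos (mul_pos (hμ _) (he _ _)) (Finset.prod_pos fun _ _ => mul_pos (hπ _ _) (he _ _))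

theorem pathWeight_snoc (n : ℕ) (μ : 𝒮 → ℝ) (π : 𝒮 → 𝒮 → ℝ) (e : 𝒮 → 𝒳 → ℝ)
    (x : Fin (n + 1) → 𝒳) (s : Fin (n + 1) → 𝒮) (y : 𝒳) (t : 𝒮) :
    pathWeight (n + 1) μ π e (Fin.snoc x y : Fin (n + 2) → 𝒳) (Fin.snoc s t : Fin (n + 2) → 𝒮) =
      pathWeight n μ π e x s * (π (s (Fin.last n)) t * e t y) := by
  have h0 : (0 : Fin (n + 2)) = Fin.castSucc 0 := rfl
  unfold pathWeight
  rw [Fin.prod_univ_castSucc, h0]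
  simp only [Fin.snoc_castSucc, Fin.succ_last, Fin.snoc_last, Fin.succ_castSucc]
  ring

variable [Fintype 𝒮] [Fintype 𝒳]

theorem sum_snoc {α : Type} [Fintype α] (n : ℕ) (f : (Fin (n + 1) → α) → ℝ) :
    ∑ z, f z = ∑ z : Fin n → α, ∑ a : α, f (Fin.snoc z a : Fin (n + 1) → α) := by
  rw [← (Fin.snocEquiv fun _ : Fin (n + 1) => α).sum_comp, Fintype.sum_prod_type,
    Finset.sum_comm]
  rfl

theorem sum_sum_snoc (n : ℕ) (f : (Fin (n + 1) → 𝒳) → (Fin (n + 1) → 𝒮) → ℝ) :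
    ∑ x, ∑ s, f x s = ∑ x : Fin n → 𝒳, ∑ s : Fin n → 𝒮, ∑ t : 𝒮, ∑ y : 𝒳,
      f (Fin.snoc x y : Fin (n + 1) → 𝒳) (Fin.snoc s t : Fin (n + 1) → 𝒮) := by
  rw [sum_snoc]
  refine Finset.sum_congr rfl fun x _ => ?_
  simp_rw [sum_snoc n (f _)]
  rw [Finset.sum_comm]
  exact Finset.sum_congr rfl fun s _ => Finset.sum_comm

/-- With no transition, a sum over paths is a sum over the single state and observation. -/
theorem sum_sum_fin_one (f : (Fin 1 → 𝒳) → (Fin 1 → 𝒮) → ℝ) :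
    ∑ x, ∑ s, f x s = ∑ t : 𝒮, ∑ y : 𝒳, f (fun _ => y) (fun _ => t) := by
  rw [Finset.sum_comm, ← (Equiv.funUnique (Fin 1) 𝒮).symm.sum_comp]
  refine Finset.sum_congr rfl fun t _ => ?_
  rw [← (Equiv.funUnique (Fin 1) 𝒳).symm.sum_comp]
  rfl

/-- The last hidden state of a path with `n` transitions has distribution `μ ⬝ π ^ n`. -/
theorem sum_pathWeight_mul_last [DecidableEq 𝒮] {μ : 𝒮 → ℝ} {π : 𝒮 → 𝒮 → ℝ} {e : 𝒮 → 𝒳 → ℝ}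
    (he : ∀ s, ∑ x, e s x = 1) (n : ℕ) (f : 𝒮 → ℝ) :
    ∑ x, ∑ s, pathWeight n μ π e x s * f (s (Fin.last n)) =
      ∑ r, ∑ t, μ r * ((Matrix.of π : Matrix 𝒮 𝒮 ℝ) ^ n) r t * f t := by
  induction n generalizing f with
  | zero =>
    rw [sum_sum_fin_one]
    simp [pathWeight, Matrix.one_apply, ← Finset.sum_mul, ← Finset.mul_sum, he]
  | succ n ih =>
    rw [sum_sum_snoc]
    have step : ∀ (x : Fin (n + 1) → 𝒳) (s : Fin (n + 1) → 𝒮),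
        (∑ t, ∑ y, pathWeight (n + 1) μ π e (Fin.snoc x y : Fin (n + 2) → 𝒳)
          (Fin.snoc s t : Fin (n + 2) → 𝒮) *
            f ((Fin.snoc s t : Fin (n + 2) → 𝒮) (Fin.last (n + 1)))) =
          pathWeight n μ π e x s * ∑ t, π (s (Fin.last n)) t * f t := by
      intro x s
      simp only [pathWeight_snoc, Fin.snoc_last, ← Finset.sum_mul, ← Finset.mul_sum, he, mul_one]
      simp only [Finset.mul_sum, mul_assoc]
    simp only [step]
    rw [ih fun r => ∑ t, π r t * f t]
    refine Finset.sum_congr rfl fun r _ => ?_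
    simp only [pow_succ, Matrix.mul_apply, Matrix.of_apply, Finset.mul_sum, Finset.sum_mul]
    rw [Finset.sum_comm]
    simp only [mul_assoc]

/-- The Kullback–Leibler distance of path weights, by induction on the number of transitions. -/
theorem sum_pathWeight_mul_log [DecidableEq 𝒮] {μ1 μ0 : 𝒮 → ℝ} {π1 π0 : 𝒮 → 𝒮 → ℝ}
    {e1 e0 : 𝒮 → 𝒳 → ℝ} (hμ1 : ∀ s, 0 < μ1 s) (hμ0 : ∀ s, 0 < μ0 s)
    (hπ1 : ∀ r s, 0 < π1 r s) (hπ1sum : ∀ r, ∑ s, π1 r s = 1) (hπ0 : ∀ r s, 0 < π0 r s)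
    (he1 : ∀ s x, 0 < e1 s x) (he1sum : ∀ s, ∑ x, e1 s x = 1) (he0 : ∀ s x, 0 < e0 s x) (n : ℕ) :
    ∑ x, ∑ s, pathWeight n μ1 π1 e1 x s *
        Real.log (pathWeight n μ1 π1 e1 x s / pathWeight n μ0 π0 e0 x s) =
      kinit μ1 μ0 e1 e0 + ∑ i ∈ Finset.range n, ∑ r, ∑ s,
        μ1 r * ((Matrix.of π1 : Matrix 𝒮 𝒮 ℝ) ^ i) r s * kfun π1 π0 e1 e0 s := by
  induction n with
  | zero =>
    rw [sum_sum_fin_one]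
    simp [pathWeight, kinit]
  | succ n ih =>
    rw [Finset.sum_range_succ, ← add_assoc, ← ih, ← sum_pathWeight_mul_last he1sum,
      sum_sum_snoc, ← Finset.sum_add_distrib]
    refine Finset.sum_congr rfl fun x _ => ?_
    rw [← Finset.sum_add_distrib]
    refine Finset.sum_congr rfl fun s _ => ?_
    have hw1 := pathWeight_pos hμ1 hπ1 he1 n x s
    have hw0 := pathWeight_pos hμ0 hπ0 he0 n x s
    have hlog : ∀ t y, Real.log (pathWeight n μ1 π1 e1 x s * (π1 (s (Fin.last n)) t * e1 t y) /
        (pathWeight n μ0 π0 e0 x s * (π0 (s (Fin.last n)) t * e0 t y))) =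
        Real.log (pathWeight n μ1 π1 e1 x s / pathWeight n μ0 π0 e0 x s) +
          Real.log (π1 (s (Fin.last n)) t * e1 t y / (π0 (s (Fin.last n)) t * e0 t y)) := by
      intro t y
      rw [mul_div_mul_comm, Real.log_mul (div_pos hw1 hw0).ne'
        (div_pos (mul_pos (hπ1 _ _) (he1 _ _)) (mul_pos (hπ0 _ _) (he0 _ _))).ne']
    simp only [pathWeight_snoc, hlog, mul_add, Finset.sum_add_distrib]
    congr 1
    · simp only [← Finset.sum_mul, ← Finset.mul_sum, he1sum, hπ1sum, mul_one]
    · simp only [kfun, Finset.mul_sum, mul_assoc]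

end HMM

open HMM in
theorem hmm_kld_closed_form
    (𝒮 𝒳 : Type) [Fintype 𝒮] [Fintype 𝒳] [Nonempty 𝒮] [Nonempty 𝒳] [DecidableEq 𝒮]
    (N : ℕ) (hN : 2 ≤ N)
    (μ1 μ0 : 𝒮 → ℝ) (π1 π0 : 𝒮 → 𝒮 → ℝ) (e1 e0 : 𝒮 → 𝒳 → ℝ)
    (hμ1pos : ∀ s, 0 < μ1 s) (hμ1sum : ∑ s, μ1 s = 1)
    (hμ0pos : ∀ s, 0 < μ0 s) (hμ0sum : ∑ s, μ0 s = 1)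
    (hπ1pos : ∀ r s, 0 < π1 r s) (hπ1sum : ∀ r, ∑ s, π1 r s = 1)
    (hπ0pos : ∀ r s, 0 < π0 r s) (hπ0sum : ∀ r, ∑ s, π0 r s = 1)
    (he1pos : ∀ s x, 0 < e1 s x) (he1sum : ∀ s, ∑ x, e1 s x = 1)
    (he0pos : ∀ s x, 0 < e0 s x) (he0sum : ∀ s, ∑ x, e0 s x = 1) :
    KLD N hN μ1 μ0 π1 π0 e1 e0 =
      kinit μ1 μ0 e1 e0 +
        ∑ i ∈ Finset.range (N - 1),
          ∑ r : 𝒮, ∑ s : 𝒮,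
            μ1 r * ((Matrix.of π1 : Matrix 𝒮 𝒮 ℝ) ^ i) r s * kfun π1 π0 e1 e0 s := by
  obtain ⟨n, rfl⟩ : ∃ n, N = n + 1 := ⟨N - 1, by omega⟩
  simp only [KLD, pmf_eq_pathWeight, Nat.add_sub_cancel]
  exact sum_pathWeight_mul_log hμ1pos hμ0pos hπ1pos hπ1sum hπ0pos he1pos he1sum he0pos n
end

section
/- For two homogeneous hidden Markov models θ₁, θ₀ with all parameters strictly positive, let ν : 𝒮 → ℝ be a stationary distribution of π_{θ₁} (i.e. ν ≥ 0, Σ_s ν(s) = 1 and Σ_r ν(r) π_{θ₁}(r,s) = ν(s) for all s). Then the Kullback–Leibler distance rate exists and equals ν ⬝ k: lim_{N→∞} D_N(θ₁‖θ₀)/N = Σ_r ν(r) k(r). -/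
section Helpers

open Finset

variable {𝒮 𝒳 : Type}

/-- The joint pmf of a hidden Markov model of length `m + 1`, indexed by its number `m` of
transitions. -/
noncomputable def HMM.chainPmf (m : ℕ) (μ : 𝒮 → ℝ) (π : 𝒮 → 𝒮 → ℝ) (e : 𝒮 → 𝒳 → ℝ)
    (x : Fin (m + 1) → 𝒳) (s : Fin (m + 1) → 𝒮) : ℝ :=
  μ (s 0) * e (s 0) (x 0) *
    ∏ i : Fin m, π (s i.castSucc) (s i.succ) * e (s i.succ) (x i.succ)

theorem HMM.pmf_succ (m : ℕ) (hN : 2 ≤ m + 1) (μ : 𝒮 → ℝ) (π : 𝒮 → 𝒮 → ℝ) (e : 𝒮 → 𝒳 → ℝ)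
    (x : Fin (m + 1) → 𝒳) (s : Fin (m + 1) → 𝒮) :
    HMM.pmf (m + 1) hN μ π e x s = HMM.chainPmf m μ π e x s := by
  unfold HMM.pmf HMM.chainPmf
  rw [Fin.prod_univ_succ]
  simp only [Fin.val_zero, if_true, one_mul]
  rfl

theorem HMM.chainPmf_cons (m : ℕ) (μ : 𝒮 → ℝ) (π : 𝒮 → 𝒮 → ℝ) (e : 𝒮 → 𝒳 → ℝ)
    (x₀ : 𝒳) (x : Fin (m + 1) → 𝒳) (s₀ : 𝒮) (s : Fin (m + 1) → 𝒮) :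
    HMM.chainPmf (m + 1) μ π e (Fin.cons x₀ x) (Fin.cons s₀ s) =
      μ s₀ * e s₀ x₀ * HMM.chainPmf m (π s₀) π e x s := by
  unfold HMM.chainPmf
  rw [Fin.prod_univ_succ]
  simp

theorem HMM.chainPmf_pos (m : ℕ) {μ : 𝒮 → ℝ} {π : 𝒮 → 𝒮 → ℝ} {e : 𝒮 → 𝒳 → ℝ}
    (hμ : ∀ s, 0 < μ s) (hπ : ∀ r s, 0 < π r s) (he : ∀ s x, 0 < e s x)
    (x : Fin (m + 1) → 𝒳) (s : Fin (m + 1) → 𝒮) : 0 < HMM.chainPmf m μ π e x s :=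
  mul_pos (mul_pos (hμ _) (he _ _)) (prod_pos fun _ _ => mul_pos (hπ _ _) (he _ _))

variable [Fintype 𝒮] [Fintype 𝒳]

theorem sum_fin_succ_pi {α : Type} [Fintype α] (n : ℕ) (F : (Fin (n + 1) → α) → ℝ) :
    ∑ x, F x = ∑ a, ∑ x : Fin n → α, F (Fin.cons a x) := by
  rw [← Fintype.sum_prod_type']
  exact (Fintype.sum_equiv (Fin.consEquiv fun _ => α) _ _ fun _ => rfl).symm

theorem sum_fin_one_pi {α : Type} [Fintype α] (F : (Fin 1 → α) → ℝ) :
    ∑ x, F x = ∑ a, F fun _ => a :=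
  Fintype.sum_equiv (Equiv.funUnique (Fin 1) α) _ _ fun x => by
    congr 1; ext i; rw [Subsingleton.elim i 0]; rfl

theorem sum_sum_fin_one_pi (F : (Fin 1 → 𝒳) → (Fin 1 → 𝒮) → ℝ) :
    ∑ x, ∑ s, F x s = ∑ s, ∑ x, F (fun _ => x) fun _ => s := by
  rw [sum_fin_one_pi, sum_comm, sum_fin_one_pi]

theorem sum_sum_fin_succ_pi (n : ℕ) (F : (Fin (n + 1) → 𝒳) → (Fin (n + 1) → 𝒮) → ℝ) :
    ∑ x, ∑ s, F x s =
      ∑ s₀, ∑ x₀, ∑ x : Fin n → 𝒳, ∑ s : Fin n → 𝒮, F (Fin.cons x₀ x) (Fin.cons s₀ s) := by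
  rw [sum_fin_succ_pi n, sum_comm' (t' := univ) (s' := fun _ => univ) (by simp)]
  simp_rw [sum_fin_succ_pi n (F _)]
  rw [sum_comm]
  simp_rw [sum_comm (s := (univ : Finset (Fin n → 𝒳))) (t := (univ : Finset 𝒮))]
  rw [sum_comm]

/-- The joint pmf has the total mass of the initial distribution. -/
theorem HMM.sum_chainPmf (m : ℕ) (μ : 𝒮 → ℝ) {π : 𝒮 → 𝒮 → ℝ} {e : 𝒮 → 𝒳 → ℝ}
    (hπ : ∀ r, ∑ s, π r s = 1) (he : ∀ s, ∑ x, e s x = 1) :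
    ∑ x, ∑ s, HMM.chainPmf m μ π e x s = ∑ s, μ s := by
  induction m generalizing μ with
  | zero =>
    rw [sum_sum_fin_one_pi]
    simp [HMM.chainPmf, ← mul_sum, he]
  | succ m ih =>
    rw [sum_sum_fin_succ_pi]
    simp_rw [HMM.chainPmf_cons, ← mul_sum, ih, hπ, mul_one, ← mul_sum, he, mul_one]

/-- The expected sum of the first `m` values of `k` along the chain `π` started at `r`. -/
noncomputable def HMM.expectedSum (π : 𝒮 → 𝒮 → ℝ) (k : 𝒮 → ℝ) : ℕ → 𝒮 → ℝ
  | 0, _ => 0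
  | m + 1, r => k r + ∑ s, π r s * HMM.expectedSum π k m s

theorem HMM.sum_chainPmf_mul_log (m : ℕ) {μ1 μ0 : 𝒮 → ℝ} {π1 π0 : 𝒮 → 𝒮 → ℝ}
    {e1 e0 : 𝒮 → 𝒳 → ℝ}
    (hμ1 : ∀ s, 0 < μ1 s) (hμ0 : ∀ s, 0 < μ0 s)
    (hπ1 : ∀ r s, 0 < π1 r s) (hπ1sum : ∀ r, ∑ s, π1 r s = 1) (hπ0 : ∀ r s, 0 < π0 r s)
    (he1 : ∀ s x, 0 < e1 s x) (he1sum : ∀ s, ∑ x, e1 s x = 1) (he0 : ∀ s x, 0 < e0 s x) :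
    ∑ x, ∑ s, HMM.chainPmf m μ1 π1 e1 x s *
        Real.log (HMM.chainPmf m μ1 π1 e1 x s / HMM.chainPmf m μ0 π0 e0 x s) =
      HMM.kinit μ1 μ0 e1 e0 +
        ∑ s, μ1 s * HMM.expectedSum π1 (HMM.kfun π1 π0 e1 e0) m s := by
  induction m generalizing μ1 μ0 with
  | zero =>
    rw [sum_sum_fin_one_pi]
    simp [HMM.chainPmf, HMM.expectedSum, HMM.kinit]
  | succ m ih =>
    have key (s₀ : 𝒮) (x₀ : 𝒳) :
        ∑ x, ∑ s, HMM.chainPmf (m + 1) μ1 π1 e1 (Fin.cons x₀ x) (Fin.cons s₀ s) *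
          Real.log (HMM.chainPmf (m + 1) μ1 π1 e1 (Fin.cons x₀ x) (Fin.cons s₀ s) /
            HMM.chainPmf (m + 1) μ0 π0 e0 (Fin.cons x₀ x) (Fin.cons s₀ s)) =
        μ1 s₀ * e1 s₀ x₀ * Real.log ((μ1 s₀ * e1 s₀ x₀) / (μ0 s₀ * e0 s₀ x₀)) +
          μ1 s₀ * e1 s₀ x₀ *
            HMM.expectedSum π1 (HMM.kfun π1 π0 e1 e0) (m + 1) s₀ := by
      have hrec : HMM.expectedSum π1 (HMM.kfun π1 π0 e1 e0) (m + 1) s₀ =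
          ∑ x, ∑ s, HMM.chainPmf m (π1 s₀) π1 e1 x s *
            Real.log (HMM.chainPmf m (π1 s₀) π1 e1 x s / HMM.chainPmf m (π0 s₀) π0 e0 x s) :=
        (ih (hπ1 s₀) (hπ0 s₀)).symm
      have hone := HMM.sum_chainPmf m (π1 s₀) hπ1sum he1sum
      rw [hπ1sum] at hone
      rw [hrec, ← mul_one (_ * Real.log _), ← hone]
      simp_rw [mul_sum, ← sum_add_distrib]
      refine sum_congr rfl fun x _ => sum_congr rfl fun s _ => ?_
      have h1 := HMM.chainPmf_pos m (hπ1 s₀) hπ1 he1 x s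
      have h0 := HMM.chainPmf_pos m (hπ0 s₀) hπ0 he0 x s
      have g1 := mul_pos (hμ1 s₀) (he1 s₀ x₀)
      have g0 := mul_pos (hμ0 s₀) (he0 s₀ x₀)
      rw [HMM.chainPmf_cons, HMM.chainPmf_cons, mul_div_mul_comm,
        Real.log_mul (div_pos g1 g0).ne' (div_pos h1 h0).ne']
      ring
    rw [sum_sum_fin_succ_pi]
    simp_rw [key, sum_add_distrib, ← sum_mul, ← mul_sum, he1sum, mul_one]
    rfl

/-- By the minorisation `δ * ν s ≤ π r s`, the expected sums stay within bounded distance of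
`m * ∑ r, ν r * k r`. -/
theorem HMM.exists_abs_expectedSum_sub_le [Nonempty 𝒮] {π : 𝒮 → 𝒮 → ℝ}
    (hπ : ∀ r s, 0 < π r s) (hπsum : ∀ r, ∑ s, π r s = 1)
    {ν : 𝒮 → ℝ} (hν : ∀ s, 0 ≤ ν s) (hνsum : ∑ s, ν s = 1)
    (hνstat : ∀ s, ∑ r, ν r * π r s = ν s) (k : 𝒮 → ℝ) :
    ∃ C, ∀ m r, |HMM.expectedSum π k m r - m * ∑ r, ν r * k r| ≤ C := by
  set c := ∑ r, ν r * k r with hc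
  obtain ⟨p, hp⟩ := Finite.exists_min fun p : 𝒮 × 𝒮 => π p.1 p.2
  set δ := π p.1 p.2
  have hδ : 0 < δ := hπ _ _
  have hν1 (s : 𝒮) : ν s ≤ 1 := hνsum ▸ single_le_sum (fun i _ => hν i) (mem_univ s)
  have hmin (r s : 𝒮) : δ * ν s ≤ π r s :=
    (mul_le_of_le_one_right hδ.le (hν1 s)).trans (hp (r, s))
  obtain ⟨q, hq⟩ := Finite.exists_max fun r => |k r - c|
  set B := |k q - c|
  have hmean (m : ℕ) : ∑ s, ν s * HMM.expectedSum π k m s = m * c := by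
    induction m with
    | zero => simp [HMM.expectedSum]
    | succ m ih =>
      simp_rw [HMM.expectedSum, mul_add, sum_add_distrib, mul_sum, ← mul_assoc]
      rw [sum_comm]
      simp_rw [← sum_mul, hνstat, ih, ← hc]
      push_cast
      ring
  refine ⟨B / δ, fun m => ?_⟩
  induction m with
  | zero =>
    intro r
    simpa [HMM.expectedSum] using div_nonneg (abs_nonneg _) hδ.le
  | succ m ih =>
    intro r
    have hzero : ∑ s, ν s * (HMM.expectedSum π k m s - m * c) = 0 := by
      simp_rw [mul_sub, sum_sub_distrib, ← sum_mul, hνsum, hmean]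
      ring
    have hstep : HMM.expectedSum π k (m + 1) r - (m + 1 : ℕ) * c =
        (k r - c) + ∑ s, (π r s - δ * ν s) * (HMM.expectedSum π k m s - m * c) := by
      simp_rw [sub_mul _ (δ * _), sum_sub_distrib, mul_assoc δ, ← mul_sum, hzero, mul_sub,
        sum_sub_distrib, ← sum_mul, hπsum, HMM.expectedSum]
      push_cast
      ring
    have hsum : |∑ s, (π r s - δ * ν s) * (HMM.expectedSum π k m s - m * c)| ≤
        (1 - δ) * (B / δ) := by
      calc _ ≤ ∑ s, (π r s - δ * ν s) * (B / δ) := by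
            refine (abs_sum_le_sum_abs _ _).trans (sum_le_sum fun s _ => ?_)
            rw [abs_mul, abs_of_nonneg (sub_nonneg.2 (hmin r s))]
            exact mul_le_mul_of_nonneg_left (ih s) (sub_nonneg.2 (hmin r s))
        _ = (1 - δ) * (B / δ) := by
            rw [← sum_mul, sum_sub_distrib, hπsum, ← mul_sum, hνsum, mul_one]
    rw [hstep]
    calc _ ≤ B + (1 - δ) * (B / δ) := (abs_add_le _ _).trans (add_le_add (hq r) hsum)
      _ = B / δ := by field_simp; ring

theorem tendsto_div_natCast_of_abs_sub_le {u : ℕ → ℝ} {c C : ℝ}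
    (h : ∀ᶠ N : ℕ in Filter.atTop, |u N - N * c| ≤ C) :
    Filter.Tendsto (fun N : ℕ => u N / N) Filter.atTop (nhds c) := by
  rw [tendsto_iff_dist_tendsto_zero]
  refine squeeze_zero' (Filter.Eventually.of_forall fun _ => dist_nonneg) ?_
    (tendsto_const_div_atTop_nhds_zero_nat C)
  filter_upwards [h, Filter.eventually_gt_atTop 0] with N hN hpos
  have hN0 : (0 : ℝ) < N := by exact_mod_cast hpos
  rw [Real.dist_eq, div_sub' hN0.ne', abs_div, abs_of_pos hN0]
  gcongr

end Helpers

open HMM in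
theorem hmm_kld_rate
    (𝒮 𝒳 : Type) [Fintype 𝒮] [Fintype 𝒳] [Nonempty 𝒮] [Nonempty 𝒳] [DecidableEq 𝒮]
    (μ1 μ0 : 𝒮 → ℝ) (π1 π0 : 𝒮 → 𝒮 → ℝ) (e1 e0 : 𝒮 → 𝒳 → ℝ)
    (hμ1pos : ∀ s, 0 < μ1 s) (hμ1sum : ∑ s, μ1 s = 1)
    (hμ0pos : ∀ s, 0 < μ0 s) (hμ0sum : ∑ s, μ0 s = 1)
    (hπ1pos : ∀ r s, 0 < π1 r s) (hπ1sum : ∀ r, ∑ s, π1 r s = 1)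
    (hπ0pos : ∀ r s, 0 < π0 r s) (hπ0sum : ∀ r, ∑ s, π0 r s = 1)
    (he1pos : ∀ s x, 0 < e1 s x) (he1sum : ∀ s, ∑ x, e1 s x = 1)
    (he0pos : ∀ s x, 0 < e0 s x) (he0sum : ∀ s, ∑ x, e0 s x = 1)
    (ν : 𝒮 → ℝ) (hνnonneg : ∀ s, 0 ≤ ν s) (hνsum : ∑ s, ν s = 1)
    (hνstat : ∀ s, ∑ r, ν r * π1 r s = ν s) :
    Filter.Tendsto
      (fun N : ℕ => (if hN : 2 ≤ N then KLD N hN μ1 μ0 π1 π0 e1 e0 else 0) / (N : ℝ))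
      Filter.atTop
      (nhds (∑ r : 𝒮, ν r * kfun π1 π0 e1 e0 r)) := by
  obtain ⟨C, hC⟩ := exists_abs_expectedSum_sub_le hπ1pos hπ1sum hνnonneg hνsum hνstat
    (kfun π1 π0 e1 e0)
  set c := ∑ r, ν r * kfun π1 π0 e1 e0 r
  refine tendsto_div_natCast_of_abs_sub_le (C := |kinit μ1 μ0 e1 e0 - c| + C) ?_
  filter_upwards [Filter.eventually_ge_atTop 2] with N hN
  obtain ⟨m, rfl⟩ : ∃ m, N = m + 1 := ⟨N - 1, by omega⟩
  rw [dif_pos hN, KLD]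
  simp_rw [pmf_succ]
  rw [sum_chainPmf_mul_log m hμ1pos hμ0pos hπ1pos hπ1sum hπ0pos he1pos he1sum he0pos]
  have hsplit : kinit μ1 μ0 e1 e0 + ∑ s, μ1 s * expectedSum π1 (kfun π1 π0 e1 e0) m s -
      (m + 1 : ℕ) * c = (kinit μ1 μ0 e1 e0 - c) +
        ∑ s, μ1 s * (expectedSum π1 (kfun π1 π0 e1 e0) m s - m * c) := by
    simp_rw [mul_sub, Finset.sum_sub_distrib, ← Finset.sum_mul, hμ1sum]
    push_cast
    ring
  rw [hsplit]
  refine (abs_add_le _ _).trans (add_le_add le_rfl ?_)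
  calc _ ≤ ∑ s, μ1 s * C := by
        refine (Finset.abs_sum_le_sum_abs _ _).trans (Finset.sum_le_sum fun s _ => ?_)
        rw [abs_mul, abs_of_pos (hμ1pos s)]
        exact mul_le_mul_of_nonneg_left (hC m s) (hμ1pos s).le
    _ = C := by rw [← Finset.sum_mul, hμ1sum, one_mul]
end

section
/- For two homogeneous hidden Markov models θ₁, θ₀ of length N ≥ 2 with all parameters strictly positive and a fixed evidence sequence x : Fin N → 𝒳, the conditional inward quantities satisfy, for every i with 1 ≤ i ≤ N-1 and every r ∈ 𝒮: K^E_{i-1}(r) = Σ_{s∈𝒮} P_{θ₁}(S_i = s | S_{i-1} = r, E) · [ log( P_{θ₁}(S_i = s | S_{i-1} = r, E) / P_{θ₀}(S_i = s | S_{i-1} = r, E) ) + K^E_i(s) ]. -/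
/-!
STATEMENT 10: Recursion for the conditional inward quantities of two HMMs given the evidence `X = x`.
-/

namespace HMMev

variable {𝒮 𝒳 : Type} [Fintype 𝒮] [Fintype 𝒳]

/-- The joint pmf `p_θ(x, s)` of a homogeneous hidden Markov model of length `N`:
`p_θ(x,s) = μ_θ(s 0) e_θ(s 0, x 0) · ∏_{i=1}^{N-1} π_θ(s(i-1), s i) e_θ(s i, x i)`. -/
noncomputable def pmf (N : ℕ) (hN : 2 ≤ N) (μ : 𝒮 → ℝ) (π : 𝒮 → 𝒮 → ℝ) (e : 𝒮 → 𝒳 → ℝ)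
    (x : Fin N → 𝒳) (s : Fin N → 𝒮) : ℝ :=
  μ (s ⟨0, by omega⟩) * e (s ⟨0, by omega⟩) (x ⟨0, by omega⟩) *
    ∏ i : Fin N,
      if i.val = 0 then 1
      else π (s ⟨i.val - 1, Nat.lt_of_le_of_lt (Nat.sub_le _ _) i.isLt⟩) (s i) * e (s i) (x i)

/-- Given the weights `w_θ(t) = p_θ(x, t)` for a fixed evidence `x`, the conditional
probability `P_θ(S_i = s | S_{i-1} = r, E)`. -/
noncomputable def condTrans {N : ℕ} [DecidableEq 𝒮] (w : (Fin N → 𝒮) → ℝ) (i : Fin N)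
    (r s : 𝒮) : ℝ :=
  (∑ t ∈ Finset.univ.filter (fun t : Fin N → 𝒮 =>
      t ⟨i.val - 1, Nat.lt_of_le_of_lt (Nat.sub_le _ _) i.isLt⟩ = r ∧ t i = s), w t) /
  (∑ t ∈ Finset.univ.filter (fun t : Fin N → 𝒮 =>
      t ⟨i.val - 1, Nat.lt_of_le_of_lt (Nat.sub_le _ _) i.isLt⟩ = r), w t)

/-- Given the weights `w_θ(t) = p_θ(x, t)` for a fixed evidence `x`, the conditional tail pmf
`Q^i_θ(τ | s)` of the hidden states strictly after position `i`, given `S_i = s`. -/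
noncomputable def condTail {N : ℕ} [DecidableEq 𝒮] (w : (Fin N → 𝒮) → ℝ) (i : Fin N) (s : 𝒮)
    (τ : {j : Fin N // i < j} → 𝒮) : ℝ :=
  (∑ t ∈ Finset.univ.filter (fun t : Fin N → 𝒮 =>
      t i = s ∧ ∀ j : {j : Fin N // i < j}, t j.val = τ j), w t) /
  (∑ t ∈ Finset.univ.filter (fun t : Fin N → 𝒮 => t i = s), w t)

/-- The conditional inward quantity `K^E_i(s)`: the Kullback–Leibler distance between the
conditional tail pmfs under `θ₁` (weights `w1`) and `θ₀` (weights `w0`). -/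
noncomputable def KE {N : ℕ} [DecidableEq 𝒮] (w1 w0 : (Fin N → 𝒮) → ℝ) (i : Fin N)
    (s : 𝒮) : ℝ :=
  ∑ τ : {j : Fin N // i < j} → 𝒮,
    condTail w1 i s τ * Real.log (condTail w1 i s τ / condTail w0 i s τ)

/-- The posterior pmf `P_θ(s | E) = w_θ(s) / Σ_{s'} w_θ(s')` of the whole hidden sequence. -/
noncomputable def post {N : ℕ} (w : (Fin N → 𝒮) → ℝ) (t : Fin N → 𝒮) : ℝ :=
  w t / ∑ t' : Fin N → 𝒮, w t'

/-- The posterior `P_θ(S_i = s | E)` of the hidden state at position `i`. -/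
noncomputable def postAt {N : ℕ} [DecidableEq 𝒮] (w : (Fin N → 𝒮) → ℝ) (i : Fin N)
    (s : 𝒮) : ℝ :=
  (∑ t ∈ Finset.univ.filter (fun t : Fin N → 𝒮 => t i = s), w t) /
  (∑ t : Fin N → 𝒮, w t)

end HMMev

namespace HMMev

variable {𝒮 𝒳 : Type} {N : ℕ}

/-- The hidden sequence that follows `t` up to position `i` and `u` afterwards. -/
def splice (i : Fin N) (t u : Fin N → 𝒮) : Fin N → 𝒮 := fun j => if j ≤ i then t j else u j

/-- Sequence weights with the Markov property at `i`: swapping the tails after `i` of two sequences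
that agree at `i` preserves the product of their weights. -/
def IsMarkovAt (w : (Fin N → 𝒮) → ℝ) (i : Fin N) : Prop :=
  ∀ t u : Fin N → 𝒮, t i = u i → w t * w u = w (splice i t u) * w (splice i u t)

theorem splice_of_le {i j : Fin N} (h : j ≤ i) (t u : Fin N → 𝒮) : splice i t u j = t j :=
  if_pos h

theorem splice_of_lt {i j : Fin N} (h : i < j) (t u : Fin N → 𝒮) : splice i t u j = u j :=
  if_neg h.not_ge

theorem splice_of_ge {i j : Fin N} (h : i ≤ j) {t u : Fin N → 𝒮} (htu : t i = u i) :
    splice i t u j = u j := by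
  rcases h.eq_or_lt with rfl | h
  · rw [splice_of_le le_rfl, htu]
  · exact splice_of_lt h t u

theorem splice_splice (i : Fin N) (t u : Fin N → 𝒮) :
    splice i (splice i t u) (splice i u t) = t := by
  funext j
  simp only [splice]
  split_ifs <;> rfl

theorem pmf_pos (hN : 2 ≤ N) {μ : 𝒮 → ℝ} {π : 𝒮 → 𝒮 → ℝ} {e : 𝒮 → 𝒳 → ℝ}
    (hμ : ∀ s, 0 < μ s) (hπ : ∀ r s, 0 < π r s) (he : ∀ s x, 0 < e s x)
    (x : Fin N → 𝒳) (t : Fin N → 𝒮) : 0 < pmf N hN μ π e x t := by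
  refine mul_pos (mul_pos (hμ _) (he _ _)) (Finset.prod_pos fun j _ => ?_)
  split_ifs
  · exact one_pos
  · exact mul_pos (hπ _ _) (he _ _)

theorem isMarkovAt_pmf (hN : 2 ≤ N) (μ : 𝒮 → ℝ) (π : 𝒮 → 𝒮 → ℝ) (e : 𝒮 → 𝒳 → ℝ)
    (x : Fin N → 𝒳) (i : Fin N) : IsMarkovAt (pmf N hN μ π e x) i := by
  intro t u htu
  have h0 : (⟨0, by omega⟩ : Fin N) ≤ i := Nat.zero_le _
  simp only [pmf, splice_of_le h0]
  rw [mul_mul_mul_comm, mul_mul_mul_comm _ (∏ _, _), ← Finset.prod_mul_distrib,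
    ← Finset.prod_mul_distrib]
  congr 1
  refine Finset.prod_congr rfl fun j _ => ?_
  split_ifs with hj
  · rfl
  rcases le_or_gt j i with hji | hij
  · have hp : (⟨j.val - 1, Nat.lt_of_le_of_lt (Nat.sub_le _ _) j.isLt⟩ : Fin N) ≤ i :=
      (Nat.sub_le _ _).trans hji
    simp only [splice_of_le hp, splice_of_le hji]
  · have hp : i ≤ (⟨j.val - 1, Nat.lt_of_le_of_lt (Nat.sub_le _ _) j.isLt⟩ : Fin N) :=
      Nat.le_sub_one_of_lt hij
    simp only [splice_of_ge hp htu, splice_of_ge hp htu.symm, splice_of_lt hij]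
    exact mul_comm _ _

/-- A tail after `p` consists of the state at the successor `i` of `p` and a tail after `i`. -/
def tailEquiv {p i : Fin N} (h : p.val + 1 = i.val) :
    𝒮 × ({j : Fin N // i < j} → 𝒮) ≃ ({j : Fin N // p < j} → 𝒮) where
  toFun q j := if hj : i < j.val then q.2 ⟨j.val, hj⟩ else q.1
  invFun τ := (τ ⟨i, Fin.lt_def.2 (by omega)⟩,
    fun j => τ ⟨j.val, (Fin.lt_def.2 (by omega) : p < i).trans j.2⟩)
  left_inv q := by
    ext j
    · simp
    · simp [j.2]
  right_inv τ := by
    funext j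
    by_cases hj : i < j.val
    · simp [hj]
    · have hji : j.val = i := by
        have := Fin.lt_def.1 j.2
        have := Fin.lt_def.not.1 hj
        exact Fin.ext (by omega)
      obtain ⟨j, hpj⟩ := j
      subst hji
      simp

theorem forall_eq_tailEquiv_iff {p i : Fin N} (h : p.val + 1 = i.val) (t : Fin N → 𝒮)
    (s : 𝒮) (τ : {j : Fin N // i < j} → 𝒮) :
    (∀ j : {j : Fin N // p < j}, t j.val = tailEquiv h (s, τ) j) ↔
      t i = s ∧ ∀ j : {j : Fin N // i < j}, t j.val = τ j := by
  have := (tailEquiv (𝒮 := 𝒮) h).symm_apply_eq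
    (x := fun j => t j.val) (y := (s, τ))
  rw [← funext_iff (f := fun j : {j : Fin N // p < j} => t j.val), ← this, Prod.ext_iff,
    funext_iff]
  rfl

variable [Fintype 𝒮]

theorem sum_filter_pos {w : (Fin N → 𝒮) → ℝ} (hw : ∀ t, 0 < w t) (P : (Fin N → 𝒮) → Prop)
    [DecidablePred P] (h : ∃ t, P t) : 0 < ∑ t ∈ Finset.univ.filter P, w t :=
  Finset.sum_pos (fun t _ => hw t) (h.imp fun _ ht => by simpa using ht)

variable [DecidableEq 𝒮]

theorem condTrans_pos {w : (Fin N → 𝒮) → ℝ} (hw : ∀ t, 0 < w t) {i : Fin N} (hi : 1 ≤ i.val)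
    (r s : 𝒮) : 0 < condTrans w i r s := by
  refine div_pos (sum_filter_pos hw _ ⟨fun j => if j = i then s else r, ?_, by simp⟩)
    (sum_filter_pos hw _ ⟨fun _ => r, rfl⟩)
  exact if_neg (Fin.ne_of_lt (Fin.lt_def.2 (by simp only; omega)))

theorem condTail_pos {w : (Fin N → 𝒮) → ℝ} (hw : ∀ t, 0 < w t) (i : Fin N) (s : 𝒮)
    (τ : {j : Fin N // i < j} → 𝒮) : 0 < condTail w i s τ :=
  div_pos
    (sum_filter_pos hw _ ⟨fun j => if hj : i < j then τ ⟨j, hj⟩ else s, by simp,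
      fun j => by simp [j.2]⟩)
    (sum_filter_pos hw _ ⟨fun _ => s, rfl⟩)

theorem sum_condTail {w : (Fin N → 𝒮) → ℝ} (hw : ∀ t, 0 < w t) (i : Fin N) (s : 𝒮) :
    ∑ τ, condTail w i s τ = 1 := by
  simp only [condTail]
  rw [← Finset.sum_div, div_eq_one_iff_eq (sum_filter_pos hw (fun t => t i = s) ⟨fun _ => s, rfl⟩).ne',
    ← Finset.sum_fiberwise (Finset.univ.filter fun t : Fin N → 𝒮 => t i = s)
      (fun t (j : {j : Fin N // i < j}) => t j.val)]
  simp only [Finset.filter_filter, funext_iff]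

theorem IsMarkovAt.sum_mul_sum {w : (Fin N → 𝒮) → ℝ} {p i : Fin N} (hw : IsMarkovAt w i)
    (hpi : p ≤ i) (r s : 𝒮) (τ : {j : Fin N // i < j} → 𝒮) :
    (∑ t ∈ Finset.univ.filter (fun t : Fin N → 𝒮 =>
        t p = r ∧ t i = s ∧ ∀ j : {j : Fin N // i < j}, t j.val = τ j), w t) *
      (∑ t ∈ Finset.univ.filter (fun t : Fin N → 𝒮 => t i = s), w t) =
    (∑ t ∈ Finset.univ.filter (fun t : Fin N → 𝒮 => t p = r ∧ t i = s), w t) *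
      (∑ t ∈ Finset.univ.filter (fun t : Fin N → 𝒮 =>
        t i = s ∧ ∀ j : {j : Fin N // i < j}, t j.val = τ j), w t) := by
  rw [Finset.sum_mul_sum, Finset.sum_mul_sum, ← Finset.sum_product', ← Finset.sum_product']
  refine Finset.sum_nbij' (fun q => (splice i q.1 q.2, splice i q.2 q.1))
    (fun q => (splice i q.1 q.2, splice i q.2 q.1)) ?_ ?_ ?_ ?_ ?_
  · rintro ⟨t, u⟩ h
    simp only [Finset.mem_product, Finset.mem_filter, Finset.mem_univ, true_and] at h ⊢
    obtain ⟨⟨htp, hti, htτ⟩, hui⟩ := h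
    simp only [splice_of_le hpi, splice_of_le le_rfl]
    exact ⟨⟨htp, hti⟩, hui, fun j => (splice_of_lt j.2 u t).trans (htτ j)⟩
  · rintro ⟨t, u⟩ h
    simp only [Finset.mem_product, Finset.mem_filter, Finset.mem_univ, true_and] at h ⊢
    obtain ⟨⟨htp, hti⟩, hui, huτ⟩ := h
    simp only [splice_of_le hpi, splice_of_le le_rfl]
    exact ⟨⟨htp, hti, fun j => (splice_of_lt j.2 t u).trans (huτ j)⟩, hui⟩
  · rintro ⟨t, u⟩ -
    simp only [splice_splice]
  · rintro ⟨t, u⟩ -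
    simp only [splice_splice]
  · rintro ⟨t, u⟩ h
    simp only [Finset.mem_product, Finset.mem_filter, Finset.mem_univ, true_and] at h
    exact hw t u (h.1.2.1.trans h.2.symm)

theorem condTail_tailEquiv {w : (Fin N → 𝒮) → ℝ} (hpos : ∀ t, 0 < w t) {i : Fin N}
    (hw : IsMarkovAt w i)
    (hi : (⟨i.val - 1, Nat.lt_of_le_of_lt (Nat.sub_le _ _) i.isLt⟩ : Fin N).val + 1 = i.val)
    (r s : 𝒮) (τ : {j : Fin N // i < j} → 𝒮) :
    condTail w ⟨i.val - 1, Nat.lt_of_le_of_lt (Nat.sub_le _ _) i.isLt⟩ r (tailEquiv hi (s, τ)) =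
      condTrans w i r s * condTail w i s τ := by
  simp only [condTail, condTrans, forall_eq_tailEquiv_iff hi]
  rw [div_mul_div_comm, ← hw.sum_mul_sum (Nat.sub_le _ _) r s τ]
  exact (mul_div_mul_right _ _
    (sum_filter_pos hpos (fun t => t i = s) ⟨fun _ => s, rfl⟩).ne').symm

theorem KE_recursion {w1 w0 : (Fin N → 𝒮) → ℝ} (h1 : ∀ t, 0 < w1 t) (h0 : ∀ t, 0 < w0 t)
    {i : Fin N} (hw1 : IsMarkovAt w1 i) (hw0 : IsMarkovAt w0 i) (hi : 1 ≤ i.val) (r : 𝒮) :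
    KE w1 w0 ⟨i.val - 1, Nat.lt_of_le_of_lt (Nat.sub_le _ _) i.isLt⟩ r =
      ∑ s, condTrans w1 i r s *
        (Real.log (condTrans w1 i r s / condTrans w0 i r s) + KE w1 w0 i s) := by
  have hi' : (⟨i.val - 1, Nat.lt_of_le_of_lt (Nat.sub_le _ _) i.isLt⟩ : Fin N).val + 1 = i.val :=
    Nat.sub_add_cancel hi
  rw [KE, ← (tailEquiv hi').sum_comp, Fintype.sum_prod_type]
  refine Finset.sum_congr rfl fun s _ => ?_
  have hlog : ∀ τ, Real.log (condTrans w1 i r s * condTail w1 i s τ /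
      (condTrans w0 i r s * condTail w0 i s τ)) =
      Real.log (condTrans w1 i r s / condTrans w0 i r s) +
        Real.log (condTail w1 i s τ / condTail w0 i s τ) := fun τ => by
    rw [mul_div_mul_comm, Real.log_mul
      (div_pos (condTrans_pos h1 hi r s) (condTrans_pos h0 hi r s)).ne'
      (div_pos (condTail_pos h1 i s τ) (condTail_pos h0 i s τ)).ne']
  simp only [condTail_tailEquiv h1 hw1 hi', condTail_tailEquiv h0 hw0 hi', hlog, mul_assoc,
    mul_add, Finset.sum_add_distrib, ← Finset.mul_sum, ← Finset.sum_mul, sum_condTail h1,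
    one_mul, KE]

end HMMev

open HMMev in
theorem hmm_evidence_inward_recursion
    (𝒮 𝒳 : Type) [Fintype 𝒮] [Fintype 𝒳] [Nonempty 𝒮] [Nonempty 𝒳] [DecidableEq 𝒮]
    (N : ℕ) (hN : 2 ≤ N)
    (μ1 μ0 : 𝒮 → ℝ) (π1 π0 : 𝒮 → 𝒮 → ℝ) (e1 e0 : 𝒮 → 𝒳 → ℝ)
    (hμ1pos : ∀ s, 0 < μ1 s) (hμ1sum : ∑ s, μ1 s = 1)
    (hμ0pos : ∀ s, 0 < μ0 s) (hμ0sum : ∑ s, μ0 s = 1)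
    (hπ1pos : ∀ r s, 0 < π1 r s) (hπ1sum : ∀ r, ∑ s, π1 r s = 1)
    (hπ0pos : ∀ r s, 0 < π0 r s) (hπ0sum : ∀ r, ∑ s, π0 r s = 1)
    (he1pos : ∀ s x, 0 < e1 s x) (he1sum : ∀ s, ∑ x, e1 s x = 1)
    (he0pos : ∀ s x, 0 < e0 s x) (he0sum : ∀ s, ∑ x, e0 s x = 1)
    (x : Fin N → 𝒳)
    (i : Fin N) (hi : 1 ≤ i.val) (r : 𝒮) :
    KE (pmf N hN μ1 π1 e1 x) (pmf N hN μ0 π0 e0 x)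
        ⟨i.val - 1, Nat.lt_of_le_of_lt (Nat.sub_le _ _) i.isLt⟩ r =
      ∑ s : 𝒮,
        condTrans (pmf N hN μ1 π1 e1 x) i r s *
          (Real.log (condTrans (pmf N hN μ1 π1 e1 x) i r s /
              condTrans (pmf N hN μ0 π0 e0 x) i r s) +
            KE (pmf N hN μ1 π1 e1 x) (pmf N hN μ0 π0 e0 x) i s) := by
  exact KE_recursion (pmf_pos hN hμ1pos hπ1pos he1pos x) (pmf_pos hN hμ0pos hπ0pos he0pos x)
    (isMarkovAt_pmf hN μ1 π1 e1 x i) (isMarkovAt_pmf hN μ0 π0 e0 x i) hi r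
end

section
/- For a homogeneous hidden Markov model θ of length N ≥ 2 with all parameters strictly positive and a fixed evidence sequence x : Fin N → 𝒳, the conditional hidden-state transition probabilities given the evidence are expressed through the backward quantities: for every 1 ≤ i ≤ N-1 and r, s ∈ 𝒮, P_θ(S_i = s | S_{i-1} = r, E) = π_θ(r,s) e_θ(s, x i) B^θ_i(s) / B^θ_{i-1}(r); moreover P_θ(S_0 = s | E) = μ_θ(s) e_θ(s, x 0) B^θ_0(s) / ( Σ_{s'∈𝒮} μ_θ(s') e_θ(s', x 0) B^θ_0(s') ). -/
namespace HMMev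

open Finset Function

/-- Resampling one coordinate multiplies the total sum by the number of states. -/
theorem card_mul_sum_eq_sum_update {ι 𝒮 : Type*} [Fintype ι] [DecidableEq ι] [Fintype 𝒮]
    (f : (ι → 𝒮) → ℝ) (i : ι) :
    (Fintype.card 𝒮 : ℝ) * ∑ t, f t = ∑ t : ι → 𝒮, ∑ s : 𝒮, f (update t i s) := by
  have hinv : Involutive
      (fun p : (ι → 𝒮) × 𝒮 => ((update p.1 i p.2, p.1 i) : (ι → 𝒮) × 𝒮)) := by
    rintro ⟨t, s⟩
    simp
  have h := Equiv.sum_comp hinv.toPerm (fun p : (ι → 𝒮) × 𝒮 => f p.1)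
  simp only [Involutive.coe_toPerm, Fintype.sum_prod_type, sum_const, card_univ,
    nsmul_eq_mul] at h
  rw [h, mul_sum]

/-- The weight of a path of an inhomogeneous chain, with initial weight `a` and transition
weights `K`, stopped at time `m`. -/
noncomputable def prefixWeight {𝒮 : Type*} {N : ℕ} (hN : 0 < N) (a : 𝒮 → ℝ)
    (K : Fin N → 𝒮 → 𝒮 → ℝ) (m : ℕ) (t : Fin N → 𝒮) : ℝ :=
  a (t ⟨0, hN⟩) * ∏ i : Fin N,
    if i.val = 0 ∨ m < i.val then 1
    else K i (t ⟨i.val - 1, Nat.lt_of_le_of_lt (Nat.sub_le _ _) i.isLt⟩) (t i)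

section prefixWeight

variable {𝒮 : Type*} {N : ℕ} (hN : 0 < N) (a : 𝒮 → ℝ) (K : Fin N → 𝒮 → 𝒮 → ℝ)

theorem prefixWeight_zero (t : Fin N → 𝒮) : prefixWeight hN a K 0 t = a (t ⟨0, hN⟩) := by
  unfold prefixWeight
  rw [prod_eq_one, mul_one]
  intro i _
  rw [if_pos (by omega)]

theorem prefixWeight_succ (m : ℕ) (hm : m + 1 < N) (t : Fin N → 𝒮) :
    prefixWeight hN a K (m + 1) t =
      prefixWeight hN a K m t * K ⟨m + 1, hm⟩ (t ⟨m, by omega⟩) (t ⟨m + 1, hm⟩) := by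
  unfold prefixWeight
  rw [mul_assoc]
  congr 1
  rw [← mul_prod_erase univ _ (mem_univ (⟨m + 1, hm⟩ : Fin N)),
    ← mul_prod_erase univ (fun i : Fin N => if i.val = 0 ∨ m < i.val then 1 else _)
      (mem_univ (⟨m + 1, hm⟩ : Fin N))]
  simp only [Nat.lt_irrefl, Nat.succ_ne_zero, or_self, if_false, Nat.lt_succ_self, or_true,
    if_true, one_mul, Nat.add_sub_cancel]
  rw [mul_comm]
  congr 1
  refine prod_congr rfl fun i hi => ?_
  have hne : i.val ≠ m + 1 := fun h => (mem_erase.1 hi).1 (Fin.ext h)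
  exact if_congr (by omega) rfl rfl

theorem prefixWeight_update (m : ℕ) (j : Fin N) (hj : m < j.val) (t : Fin N → 𝒮) (s : 𝒮) :
    prefixWeight hN a K m (update t j s) = prefixWeight hN a K m t := by
  have key : ∀ k : Fin N, k.val ≤ m → update t j s k = t k := fun k hk =>
    update_of_ne (fun h => by subst h; omega) _ _
  unfold prefixWeight
  rw [key _ (Nat.zero_le _)]
  congr 1
  refine prod_congr rfl fun i _ => ?_
  split_ifs with h
  · rfl
  · rw [key _ (by simp only; omega), key _ (by omega)]

theorem prefixWeight_pos (ha : ∀ s, 0 < a s) (hK : ∀ i r s, 0 < K i r s) (m : ℕ)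
    (t : Fin N → 𝒮) : 0 < prefixWeight hN a K m t := by
  refine mul_pos (ha _) (prod_pos fun i _ => ?_)
  split_ifs
  · exact one_pos
  · exact hK _ _ _

/-- Summing out the coordinates after time `i` replaces the remaining transition weights by
the backward quantity at time `i`. -/
theorem card_pow_mul_sum_prefixWeight [Fintype 𝒮] (B : ℕ → 𝒮 → ℝ)
    (hBtop : ∀ s, B (N - 1) s = 1)
    (hBrec : ∀ i : Fin N, 1 ≤ i.val → ∀ r, B (i.val - 1) r = ∑ s, K i r s * B i.val s)
    (k : ℕ) (i : Fin N) (hi : i.val + k = N - 1) (C : (Fin N → 𝒮) → ℝ)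
    (hC : ∀ j : Fin N, i < j → ∀ t s, C (update t j s) = C t) :
    (Fintype.card 𝒮 : ℝ) ^ k * ∑ t, C t * prefixWeight hN a K (N - 1) t =
      ∑ t, C t * prefixWeight hN a K i.val t * B i.val (t i) := by
  induction k generalizing i with
  | zero =>
    rw [add_zero] at hi
    simp [hi, hBtop]
  | succ k ih =>
    have hlt : i.val + 1 < N := by omega
    rw [pow_succ', mul_assoc,
      ih ⟨i.val + 1, hlt⟩ (by simp only; omega)
        fun j hj => hC j (lt_trans (Nat.lt_succ_self i.val) hj),
      card_mul_sum_eq_sum_update _ ⟨i.val + 1, hlt⟩]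
    refine sum_congr rfl fun t _ => ?_
    have hrec := hBrec ⟨i.val + 1, hlt⟩ (Nat.le_add_left 1 i.val) (t i)
    simp only [Nat.add_sub_cancel] at hrec
    rw [hrec, mul_sum]
    refine sum_congr rfl fun s _ => ?_
    have hne : i ≠ ⟨i.val + 1, hlt⟩ := fun h => absurd (congrArg Fin.val h) (by simp)
    rw [prefixWeight_succ hN a K i.val hlt, hC _ (Nat.lt_succ_self i.val),
      prefixWeight_update hN a K i.val _ (Nat.lt_succ_self i.val), update_self,
      update_of_ne hne]
    ring

end prefixWeight

theorem pmf_eq_prefixWeight {𝒮 𝒳 : Type} (N : ℕ) (hN : 2 ≤ N) (μ : 𝒮 → ℝ)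
    (π : 𝒮 → 𝒮 → ℝ) (e : 𝒮 → 𝒳 → ℝ) (x : Fin N → 𝒳) (t : Fin N → 𝒮) :
    pmf N hN μ π e x t =
      prefixWeight (by omega) (fun s => μ s * e s (x ⟨0, by omega⟩))
        (fun i r s => π r s * e s (x i)) (N - 1) t := by
  unfold pmf prefixWeight
  congr 1
  exact prod_congr rfl fun i _ => if_congr (by omega) rfl rfl

end HMMev

open HMMev in
theorem hmm_evidence_cond_via_backward
    (𝒮 𝒳 : Type) [Fintype 𝒮] [Fintype 𝒳] [Nonempty 𝒮] [Nonempty 𝒳] [DecidableEq 𝒮]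
    (N : ℕ) (hN : 2 ≤ N)
    (μ : 𝒮 → ℝ) (π : 𝒮 → 𝒮 → ℝ) (e : 𝒮 → 𝒳 → ℝ)
    (hμpos : ∀ s, 0 < μ s) (hμsum : ∑ s, μ s = 1)
    (hπpos : ∀ r s, 0 < π r s) (hπsum : ∀ r, ∑ s, π r s = 1)
    (hepos : ∀ s x, 0 < e s x) (hesum : ∀ s, ∑ x, e s x = 1)
    (x : Fin N → 𝒳)
    (B : ℕ → 𝒮 → ℝ)
    (hBtop : ∀ s, B (N - 1) s = 1)
    (hBrec : ∀ i : Fin N, 1 ≤ i.val → ∀ r : 𝒮,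
      B (i.val - 1) r = ∑ s : 𝒮, π r s * e s (x i) * B i.val s) :
    (∀ i : Fin N, 1 ≤ i.val → ∀ r s : 𝒮,
        condTrans (pmf N hN μ π e x) i r s =
          π r s * e s (x i) * B i.val s / B (i.val - 1) r) ∧
      (∀ s : 𝒮,
        postAt (pmf N hN μ π e x) ⟨0, by omega⟩ s =
          μ s * e s (x ⟨0, by omega⟩) * B 0 s /
            ∑ s' : 𝒮, μ s' * e s' (x ⟨0, by omega⟩) * B 0 s') := by
  have hN0 : 0 < N := by omega
  have hc : (Fintype.card 𝒮 : ℝ) ≠ 0 := by exact_mod_cast Fintype.card_ne_zero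
  set a : 𝒮 → ℝ := fun s => μ s * e s (x ⟨0, hN0⟩)
  set K : Fin N → 𝒮 → 𝒮 → ℝ := fun i r s => π r s * e s (x i)
  have hw : pmf N hN μ π e x = prefixWeight hN0 a K (N - 1) :=
    funext fun t => pmf_eq_prefixWeight N hN μ π e x t
  have main := card_pow_mul_sum_prefixWeight hN0 a K B hBtop hBrec
  rw [hw]
  refine ⟨?_, fun s => ?_⟩
  · rintro ⟨_ | m, hm⟩ hi r s
    · exact absurd hi (by simp)
    have hm' : m < N := by omega
    simp only [condTrans, Nat.add_sub_cancel, Finset.sum_filter]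
    have hne : (⟨m, hm'⟩ : Fin N) ≠ ⟨m + 1, hm⟩ := by simp
    have hden := main (N - 1 - m) ⟨m, hm'⟩ (by simp only; omega)
      (fun t => if t ⟨m, hm'⟩ = r then 1 else 0)
      (fun j hj t q => by rw [Function.update_of_ne hj.ne])
    have hnum := main (N - 1 - (m + 1)) ⟨m + 1, hm⟩ (by simp only; omega)
      (fun t => if t ⟨m, hm'⟩ = r ∧ t ⟨m + 1, hm⟩ = s then 1 else 0)
      (fun j hj t q => by
        have hj' : (⟨m, hm'⟩ : Fin N) < j := lt_trans (Nat.lt_succ_self m) hj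
        rw [Function.update_of_ne hj.ne, Function.update_of_ne hj'.ne])
    have hnum' := congrArg ((Fintype.card 𝒮 : ℝ) * ·) hnum
    simp only [card_mul_sum_eq_sum_update _ (⟨m + 1, hm⟩ : Fin N), ← mul_assoc,
      ← pow_succ'] at hnum'
    rw [show N - 1 - (m + 1) + 1 = N - 1 - m by omega] at hnum'
    simp only [prefixWeight_succ hN0 a K m hm,
      prefixWeight_update hN0 a K m ⟨m + 1, hm⟩ (Nat.lt_succ_self m), Function.update_self,
      Function.update_of_ne hne] at hnum'
    set D := ∑ t : Fin N → 𝒮, if t ⟨m, hm'⟩ = r then prefixWeight hN0 a K m t else 0 with hD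
    have hDpos : 0 < D := by
      have hpos := prefixWeight_pos hN0 a K (fun s => mul_pos (hμpos s) (hepos s _))
        (fun i r s => mul_pos (hπpos r s) (hepos s _)) m
      refine Finset.sum_pos' (fun t _ => ?_) ⟨fun _ => r, Finset.mem_univ _, ?_⟩
      · split_ifs
        exacts [(hpos t).le, le_rfl]
      · simpa using hpos fun _ => r
    have hden_eq : (Fintype.card 𝒮 : ℝ) ^ (N - 1 - m) *
        (∑ t : Fin N → 𝒮, if t ⟨m, hm'⟩ = r then prefixWeight hN0 a K (N - 1) t else 0) =
        D * B m r := by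
      simp only [ite_mul, one_mul, zero_mul] at hden
      rw [hden, hD, Finset.sum_mul]
      refine Finset.sum_congr rfl fun t _ => ?_
      split_ifs with h
      · rw [h]
      · simp
    have hnum_eq : (Fintype.card 𝒮 : ℝ) ^ (N - 1 - m) *
        (∑ t : Fin N → 𝒮, if t ⟨m, hm'⟩ = r ∧ t ⟨m + 1, hm⟩ = s then
          prefixWeight hN0 a K (N - 1) t else 0) =
        D * (K ⟨m + 1, hm⟩ r s * B (m + 1) s) := by
      simp only [ite_mul, one_mul, zero_mul] at hnum'
      rw [hnum', hD, Finset.sum_mul]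
      refine Finset.sum_congr rfl fun t _ => ?_
      by_cases h : t ⟨m, hm'⟩ = r
      · simp [h, mul_assoc]
      · simp [h]
    rw [← mul_div_mul_left _ _ (pow_ne_zero (N - 1 - m) hc), hden_eq, hnum_eq,
      mul_div_mul_left _ _ hDpos.ne']
  · simp only [postAt, Finset.sum_filter]
    have hmarg : ∀ c : 𝒮 → ℝ, (Fintype.card 𝒮 : ℝ) ^ (N - 1 + 1) *
        (∑ t : Fin N → 𝒮, c (t ⟨0, hN0⟩) * prefixWeight hN0 a K (N - 1) t) =
        (Fintype.card (Fin N → 𝒮) : ℝ) * ∑ q, c q * (a q * B 0 q) := by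
      intro c
      rw [pow_succ', mul_assoc, main (N - 1) ⟨0, hN0⟩ (by simp) (fun t => c (t ⟨0, hN0⟩))
        (fun j hj t q => by rw [Function.update_of_ne hj.ne]),
        card_mul_sum_eq_sum_update _ (⟨0, hN0⟩ : Fin N)]
      simp [prefixWeight_zero, mul_assoc]
    have hnum := hmarg fun q => if q = s then 1 else 0
    have hden := hmarg fun _ => 1
    simp only [ite_mul, one_mul, zero_mul, Finset.sum_ite_eq', Finset.mem_univ,
      if_true] at hnum hden
    have hcf : (Fintype.card (Fin N → 𝒮) : ℝ) ≠ 0 := by exact_mod_cast Fintype.card_ne_zero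
    rw [← mul_div_mul_left _ _ (pow_ne_zero (N - 1 + 1) hc), hnum, hden,
      mul_div_mul_left _ _ hcf]
end

section
/- For two homogeneous hidden Markov models θ₁, θ₀ of length N ≥ 2 with all parameters strictly positive, the Kullback–Leibler distance equals Do's bound U: D_N(θ₁‖θ₀) = D(μ) + μ_{θ₁} ⬝ ( Σ_{i=1}^{N-1} π_{θ₁}^{i-1} ⬝ (Dπ + De) + π_{θ₁}^{N-1} ⬝ De ), where μ_{θ₁} is viewed as a row vector, π_{θ₁} as a square matrix indexed by 𝒮, and Dπ, De as column vectors. -/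
/-!
STATEMENT 14: The KLD between two homogeneous hidden Markov models equals Do's bound `U`.
-/

namespace HMMDo

variable {𝒮 𝒳 : Type} [Fintype 𝒮] [Fintype 𝒳]

/-- The joint pmf `p_θ(x, s)` of a homogeneous hidden Markov model of length `N`. -/
noncomputable def pmf (N : ℕ) (hN : 2 ≤ N) (μ : 𝒮 → ℝ) (π : 𝒮 → 𝒮 → ℝ) (e : 𝒮 → 𝒳 → ℝ)
    (x : Fin N → 𝒳) (s : Fin N → 𝒮) : ℝ :=
  μ (s ⟨0, by omega⟩) * e (s ⟨0, by omega⟩) (x ⟨0, by omega⟩) *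
    ∏ i : Fin N,
      if i.val = 0 then 1
      else π (s ⟨i.val - 1, Nat.lt_of_le_of_lt (Nat.sub_le _ _) i.isLt⟩) (s i) * e (s i) (x i)

/-- The Kullback–Leibler distance `D_N(θ₁ ‖ θ₀)` between the joint pmfs of two homogeneous
hidden Markov models of length `N`. -/
noncomputable def KLD (N : ℕ) (hN : 2 ≤ N) (μ1 μ0 : 𝒮 → ℝ) (π1 π0 : 𝒮 → 𝒮 → ℝ)
    (e1 e0 : 𝒮 → 𝒳 → ℝ) : ℝ :=
  ∑ x : Fin N → 𝒳, ∑ s : Fin N → 𝒮,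
    pmf N hN μ1 π1 e1 x s * Real.log (pmf N hN μ1 π1 e1 x s / pmf N hN μ0 π0 e0 x s)

/-- `D(μ) = Σ_s μ₁(s) log(μ₁(s)/μ₀(s))`. -/
noncomputable def Dmu (μ1 μ0 : 𝒮 → ℝ) : ℝ :=
  ∑ s : 𝒮, μ1 s * Real.log (μ1 s / μ0 s)

/-- `Dπ(r) = Σ_s π₁(r,s) log(π₁(r,s)/π₀(r,s))`. -/
noncomputable def Dpi (π1 π0 : 𝒮 → 𝒮 → ℝ) (r : 𝒮) : ℝ :=
  ∑ s : 𝒮, π1 r s * Real.log (π1 r s / π0 r s)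

/-- `De(s) = Σ_x e₁(s,x) log(e₁(s,x)/e₀(s,x))`. -/
noncomputable def De (e1 e0 : 𝒮 → 𝒳 → ℝ) (s : 𝒮) : ℝ :=
  ∑ x : 𝒳, e1 s x * Real.log (e1 s x / e0 s x)

end HMMDo

namespace HMMDo

section Chain

variable {𝒮 𝒳 : Type}

/-- The joint pmf of a hidden Markov model of length `n + 1`, by recursion on the first state. -/
def chainPmf (π : 𝒮 → 𝒮 → ℝ) (e : 𝒮 → 𝒳 → ℝ) :
    (n : ℕ) → (μ : 𝒮 → ℝ) → (Fin (n + 1) → 𝒳) → (Fin (n + 1) → 𝒮) → ℝ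
  | 0, μ, x, s => μ (s 0) * e (s 0) (x 0)
  | n + 1, μ, x, s =>
    μ (s 0) * e (s 0) (x 0) * chainPmf π e n (π (s 0)) (Fin.tail x) (Fin.tail s)

theorem chainPmf_eq_prod (π : 𝒮 → 𝒮 → ℝ) (e : 𝒮 → 𝒳 → ℝ) (n : ℕ) (μ : 𝒮 → ℝ)
    (x : Fin (n + 1) → 𝒳) (s : Fin (n + 1) → 𝒮) :
    chainPmf π e n μ x s = μ (s 0) * e (s 0) (x 0) *
      ∏ i : Fin n, π (s i.castSucc) (s i.succ) * e (s i.succ) (x i.succ) := by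
  induction n generalizing μ with
  | zero => simp [chainPmf]
  | succ n ih =>
    rw [chainPmf, ih, Fin.prod_univ_succ]
    rfl

theorem pmf_succ_eq_chainPmf (n : ℕ) (hn : 2 ≤ n + 1) (μ : 𝒮 → ℝ) (π : 𝒮 → 𝒮 → ℝ)
    (e : 𝒮 → 𝒳 → ℝ) (x : Fin (n + 1) → 𝒳) (s : Fin (n + 1) → 𝒮) :
    pmf (n + 1) hn μ π e x s = chainPmf π e n μ x s := by
  rw [chainPmf_eq_prod, pmf, Fin.prod_univ_succ]
  simp only [Fin.val_zero, if_true, one_mul, Fin.val_succ, Nat.succ_ne_zero, if_false]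
  rfl

theorem chainPmf_pos {π : 𝒮 → 𝒮 → ℝ} {e : 𝒮 → 𝒳 → ℝ} (hπ : ∀ r s, 0 < π r s)
    (he : ∀ s x, 0 < e s x) (n : ℕ) {μ : 𝒮 → ℝ} (hμ : ∀ s, 0 < μ s)
    (x : Fin (n + 1) → 𝒳) (s : Fin (n + 1) → 𝒮) : 0 < chainPmf π e n μ x s := by
  induction n generalizing μ with
  | zero => exact mul_pos (hμ _) (he _ _)
  | succ n ih => exact mul_pos (mul_pos (hμ _) (he _ _)) (ih (hπ _) _ _)

theorem sum_fin_succ_fun {α : Type*} [Fintype α] (n : ℕ) (f : (Fin (n + 1) → α) → ℝ) :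
    ∑ x, f x = ∑ a, ∑ x : Fin n → α, f (Fin.cons a x) := by
  rw [← Fintype.sum_prod_type', ← (Fin.consEquiv fun _ => α).sum_comp]
  rfl

variable [Fintype 𝒮] [Fintype 𝒳]

theorem sum_sum_fin_succ_fun (n : ℕ) (f : (Fin (n + 1) → 𝒳) → (Fin (n + 1) → 𝒮) → ℝ) :
    ∑ x, ∑ s, f x s =
      ∑ b, ∑ a, ∑ x : Fin n → 𝒳, ∑ s : Fin n → 𝒮, f (Fin.cons a x) (Fin.cons b s) := by
  simp only [sum_fin_succ_fun n]
  exact (Finset.sum_congr rfl fun a _ => Finset.sum_comm).trans Finset.sum_comm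

theorem sum_sum_fin_one_fun (f : (Fin 1 → 𝒳) → (Fin 1 → 𝒮) → ℝ) :
    ∑ x, ∑ s, f x s = ∑ b, ∑ a, f (fun _ => a) fun _ => b := by
  rw [Finset.sum_comm, ← (Equiv.funUnique (Fin 1) 𝒮).symm.sum_comp]
  exact Finset.sum_congr rfl fun b _ => ((Equiv.funUnique (Fin 1) 𝒳).symm.sum_comp _).symm

theorem sum_chainPmf {π : 𝒮 → 𝒮 → ℝ} {e : 𝒮 → 𝒳 → ℝ} (hπ : ∀ r, ∑ s, π r s = 1)
    (he : ∀ s, ∑ x, e s x = 1) (n : ℕ) {μ : 𝒮 → ℝ} (hμ : ∑ s, μ s = 1) :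
    ∑ x, ∑ s, chainPmf π e n μ x s = 1 := by
  induction n generalizing μ with
  | zero =>
    rw [sum_sum_fin_one_fun]
    simp only [chainPmf, ← Finset.mul_sum, he, hμ, mul_one]
  | succ n ih =>
    simp only [sum_sum_fin_succ_fun, chainPmf, Fin.cons_zero, Fin.tail_cons, ← Finset.mul_sum,
      ih (hπ _), he, hμ, mul_one]

/-- The Kullback–Leibler distance between the joint pmfs of two hidden Markov models of length
`n + 1`. -/
noncomputable def chainKLD (π1 π0 : 𝒮 → 𝒮 → ℝ) (e1 e0 : 𝒮 → 𝒳 → ℝ) (n : ℕ)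
    (μ1 μ0 : 𝒮 → ℝ) : ℝ :=
  ∑ x, ∑ s, chainPmf π1 e1 n μ1 x s *
    Real.log (chainPmf π1 e1 n μ1 x s / chainPmf π0 e0 n μ0 x s)

variable {π1 π0 : 𝒮 → 𝒮 → ℝ} {e1 e0 : 𝒮 → 𝒳 → ℝ}

theorem chainKLD_zero (he1pos : ∀ s x, 0 < e1 s x) (he1sum : ∀ s, ∑ x, e1 s x = 1)
    (he0pos : ∀ s x, 0 < e0 s x) {μ1 μ0 : 𝒮 → ℝ} (hμ1 : ∀ s, 0 < μ1 s) (hμ0 : ∀ s, 0 < μ0 s) :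
    chainKLD π1 π0 e1 e0 0 μ1 μ0 = Dmu μ1 μ0 + ∑ r, μ1 r * De e1 e0 r := by
  rw [chainKLD, sum_sum_fin_one_fun]
  simp only [chainPmf, Dmu, De]
  rw [← Finset.sum_add_distrib]
  refine Finset.sum_congr rfl fun b _ => ?_
  have h (a : 𝒳) : μ1 b * e1 b a * Real.log (μ1 b * e1 b a / (μ0 b * e0 b a)) =
      μ1 b * Real.log (μ1 b / μ0 b) * e1 b a + μ1 b * (e1 b a * Real.log (e1 b a / e0 b a)) := by
    rw [mul_div_mul_comm, Real.log_mul (div_pos (hμ1 b) (hμ0 b)).ne'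
      (div_pos (he1pos b a) (he0pos b a)).ne']
    ring
  simp only [h, Finset.sum_add_distrib, ← Finset.mul_sum, he1sum, mul_one]

theorem chainKLD_succ (hπ1pos : ∀ r s, 0 < π1 r s) (hπ1sum : ∀ r, ∑ s, π1 r s = 1)
    (hπ0pos : ∀ r s, 0 < π0 r s) (he1pos : ∀ s x, 0 < e1 s x) (he1sum : ∀ s, ∑ x, e1 s x = 1)
    (he0pos : ∀ s x, 0 < e0 s x) (n : ℕ) {μ1 μ0 : 𝒮 → ℝ} (hμ1 : ∀ s, 0 < μ1 s)
    (hμ0 : ∀ s, 0 < μ0 s) :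
    chainKLD π1 π0 e1 e0 (n + 1) μ1 μ0 = Dmu μ1 μ0 +
      ∑ r, μ1 r * (De e1 e0 r + chainKLD π1 π0 e1 e0 n (π1 r) (π0 r)) := by
  rw [chainKLD, sum_sum_fin_succ_fun]
  simp only [chainPmf, Fin.cons_zero, Fin.tail_cons, Dmu, De]
  rw [← Finset.sum_add_distrib]
  refine Finset.sum_congr rfl fun b _ => ?_
  have h (a : 𝒳) (x : Fin (n + 1) → 𝒳) (s : Fin (n + 1) → 𝒮) :
      μ1 b * e1 b a * chainPmf π1 e1 n (π1 b) x s *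
        Real.log (μ1 b * e1 b a * chainPmf π1 e1 n (π1 b) x s /
          (μ0 b * e0 b a * chainPmf π0 e0 n (π0 b) x s)) =
      (μ1 b * Real.log (μ1 b / μ0 b) * e1 b a + μ1 b * (e1 b a * Real.log (e1 b a / e0 b a))) *
        chainPmf π1 e1 n (π1 b) x s +
      μ1 b * e1 b a * (chainPmf π1 e1 n (π1 b) x s *
        Real.log (chainPmf π1 e1 n (π1 b) x s / chainPmf π0 e0 n (π0 b) x s)) := by
    have hμ := (div_pos (hμ1 b) (hμ0 b)).ne'
    have he := (div_pos (he1pos b a) (he0pos b a)).ne'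
    have hp := (div_pos (chainPmf_pos hπ1pos he1pos n (hπ1pos b) x s)
      (chainPmf_pos hπ0pos he0pos n (hπ0pos b) x s)).ne'
    rw [mul_div_mul_comm, mul_div_mul_comm, Real.log_mul (mul_ne_zero hμ he) hp,
      Real.log_mul hμ he]
    ring
  simp only [h, Finset.sum_add_distrib, ← Finset.mul_sum, ← Finset.sum_mul, he1sum,
    sum_chainPmf hπ1sum he1sum n (hπ1sum b), mul_one]
  rw [chainKLD]
  ring

open Matrix in
theorem chainKLD_eq [DecidableEq 𝒮] (hπ1pos : ∀ r s, 0 < π1 r s)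
    (hπ1sum : ∀ r, ∑ s, π1 r s = 1) (hπ0pos : ∀ r s, 0 < π0 r s)
    (he1pos : ∀ s x, 0 < e1 s x) (he1sum : ∀ s, ∑ x, e1 s x = 1)
    (he0pos : ∀ s x, 0 < e0 s x) (n : ℕ) {μ1 μ0 : 𝒮 → ℝ} (hμ1 : ∀ s, 0 < μ1 s)
    (hμ0 : ∀ s, 0 < μ0 s) :
    chainKLD π1 π0 e1 e0 n μ1 μ0 = Dmu μ1 μ0 + μ1 ⬝ᵥ
      (∑ i ∈ Finset.range n, (Matrix.of π1 ^ i) *ᵥ (fun s => Dpi π1 π0 s + De e1 e0 s) +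
        (Matrix.of π1 ^ n) *ᵥ De e1 e0) := by
  induction n generalizing μ1 μ0 with
  | zero =>
    rw [chainKLD_zero he1pos he1sum he0pos hμ1 hμ0]
    simp [dotProduct]
  | succ n ih =>
    rw [chainKLD_succ hπ1pos hπ1sum hπ0pos he1pos he1sum he0pos n hμ1 hμ0]
    congr 1
    refine Finset.sum_congr rfl fun r _ => ?_
    rw [ih (hπ1pos r) (hπ0pos r), Finset.sum_range_succ']
    simp only [pow_succ', ← mulVec_mulVec, pow_zero, one_mulVec]
    rw [← mulVec_sum, add_right_comm, ← mulVec_add]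
    simp only [Pi.add_apply, mulVec, Matrix.of_apply]
    rw [show Dpi π1 π0 r = Dmu (π1 r) (π0 r) from rfl]
    ring!

end Chain

end HMMDo

open HMMDo in
theorem hmm_kld_eq_do_bound
    (𝒮 𝒳 : Type) [Fintype 𝒮] [Fintype 𝒳] [Nonempty 𝒮] [Nonempty 𝒳] [DecidableEq 𝒮]
    (N : ℕ) (hN : 2 ≤ N)
    (μ1 μ0 : 𝒮 → ℝ) (π1 π0 : 𝒮 → 𝒮 → ℝ) (e1 e0 : 𝒮 → 𝒳 → ℝ)
    (hμ1pos : ∀ s, 0 < μ1 s) (hμ1sum : ∑ s, μ1 s = 1)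
    (hμ0pos : ∀ s, 0 < μ0 s) (hμ0sum : ∑ s, μ0 s = 1)
    (hπ1pos : ∀ r s, 0 < π1 r s) (hπ1sum : ∀ r, ∑ s, π1 r s = 1)
    (hπ0pos : ∀ r s, 0 < π0 r s) (hπ0sum : ∀ r, ∑ s, π0 r s = 1)
    (he1pos : ∀ s x, 0 < e1 s x) (he1sum : ∀ s, ∑ x, e1 s x = 1)
    (he0pos : ∀ s x, 0 < e0 s x) (he0sum : ∀ s, ∑ x, e0 s x = 1) :
    KLD N hN μ1 μ0 π1 π0 e1 e0 =
      Dmu μ1 μ0 +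
        ∑ r : 𝒮, μ1 r *
          ((∑ i ∈ Finset.Icc 1 (N - 1),
              ((Matrix.of π1 : Matrix 𝒮 𝒮 ℝ) ^ (i - 1)).mulVec
                (fun s => Dpi π1 π0 s + De e1 e0 s) r) +
            ((Matrix.of π1 : Matrix 𝒮 𝒮 ℝ) ^ (N - 1)).mulVec (De e1 e0) r) := by
  obtain ⟨n, rfl⟩ : ∃ n, N = n + 1 := ⟨N - 1, by omega⟩
  have h : KLD (n + 1) hN μ1 μ0 π1 π0 e1 e0 = chainKLD π1 π0 e1 e0 n μ1 μ0 := by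
    simp only [KLD, pmf_succ_eq_chainPmf, chainKLD]
  rw [h, chainKLD_eq hπ1pos hπ1sum hπ0pos he1pos he1sum he0pos n hμ1pos hμ0pos]
  have hIcc (f : ℕ → ℝ) : ∑ i ∈ Finset.Icc 1 n, f (i - 1) = ∑ i ∈ Finset.range n, f i :=
    Finset.sum_nbij' (· - 1) (· + 1) (by simp; omega) (by simp) (by simp; omega)
      (by simp) (by simp)
  simp only [dotProduct, Pi.add_apply, Finset.sum_apply, Nat.add_sub_cancel]
  congr! 4 with r
  exact (hIcc _).symm
end

section
/- For two Markov chains of length N ≥ 2 on a finite state space with strictly positive parameters (μ_{θ₁}, π_{θ₁}) and (μ_{θ₀}, π_{θ₀}), the Kullback–Leibler distance between the laws of the whole trajectory admits the closed form D_N(θ₁‖θ₀) := Σ_{s : Fin N → 𝒮} p_{θ₁}(s) log(p_{θ₁}(s)/p_{θ₀}(s)) = D(μ) + Σ_{i=0}^{N-2} ( μ_{θ₁} ⬝ π_{θ₁}^i ⬝ Dπ ), where μ_{θ₁} is viewed as a row vector, π_{θ₁} as a square matrix indexed by 𝒮, and Dπ as a column vector. -/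
/-!
STATEMENT 16: Closed form for the KLD between two Markov chains of length `N`.
-/

namespace MC

variable {𝒮 : Type} [Fintype 𝒮]

/-- The pmf `p_θ(s) = μ_θ(s 0) · ∏_{i=1}^{N-1} π_θ(s(i-1), s i)` of a Markov chain of
length `N` on trajectories `s : Fin N → 𝒮`. -/
noncomputable def pmf (N : ℕ) (hN : 2 ≤ N) (μ : 𝒮 → ℝ) (π : 𝒮 → 𝒮 → ℝ)
    (s : Fin N → 𝒮) : ℝ :=
  μ (s ⟨0, by omega⟩) *
    ∏ i : Fin N,
      if i.val = 0 then 1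
      else π (s ⟨i.val - 1, Nat.lt_of_le_of_lt (Nat.sub_le _ _) i.isLt⟩) (s i)

/-- The Kullback–Leibler distance `D_N(θ₁ ‖ θ₀)` between the laws of the whole trajectories
of two Markov chains of length `N`. -/
noncomputable def KLD (N : ℕ) (hN : 2 ≤ N) (μ1 μ0 : 𝒮 → ℝ) (π1 π0 : 𝒮 → 𝒮 → ℝ) : ℝ :=
  ∑ s : Fin N → 𝒮,
    pmf N hN μ1 π1 s * Real.log (pmf N hN μ1 π1 s / pmf N hN μ0 π0 s)

/-- `D(μ) = Σ_s μ₁(s) log(μ₁(s)/μ₀(s))`. -/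
noncomputable def Dmu (μ1 μ0 : 𝒮 → ℝ) : ℝ :=
  ∑ s : 𝒮, μ1 s * Real.log (μ1 s / μ0 s)

/-- `Dπ(r) = Σ_s π₁(r,s) log(π₁(r,s)/π₀(r,s))`. -/
noncomputable def Dpi (π1 π0 : 𝒮 → 𝒮 → ℝ) (r : 𝒮) : ℝ :=
  ∑ s : 𝒮, π1 r s * Real.log (π1 r s / π0 r s)

end MC

namespace MC

/-- The pmf of a Markov chain on trajectories with `n` transitions. -/
noncomputable def pathPmf {𝒮 : Type} (n : ℕ) (μ : 𝒮 → ℝ) (π : 𝒮 → 𝒮 → ℝ)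
    (s : Fin (n + 1) → 𝒮) : ℝ :=
  μ (s 0) * ∏ i : Fin n, π (s i.castSucc) (s i.succ)

theorem pmf_eq_pathPmf {𝒮 : Type} (n : ℕ) (hn : 2 ≤ n + 1) (μ : 𝒮 → ℝ)
    (π : 𝒮 → 𝒮 → ℝ) (s : Fin (n + 1) → 𝒮) :
    pmf (n + 1) hn μ π s = pathPmf n μ π s := by
  unfold pmf pathPmf
  rw [Fin.prod_univ_succ, if_pos (by simp), one_mul]
  rfl

theorem pathPmf_pos {𝒮 : Type} (n : ℕ) {μ : 𝒮 → ℝ} {π : 𝒮 → 𝒮 → ℝ}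
    (hμ : ∀ s, 0 < μ s) (hπ : ∀ r s, 0 < π r s) (s : Fin (n + 1) → 𝒮) :
    0 < pathPmf n μ π s :=
  mul_pos (hμ _) (Finset.prod_pos fun _ _ => hπ _ _)

theorem pathPmf_snoc {𝒮 : Type} (n : ℕ) (μ : 𝒮 → ℝ) (π : 𝒮 → 𝒮 → ℝ)
    (s : Fin (n + 1) → 𝒮) (x : 𝒮) :
    pathPmf (n + 1) μ π (Fin.snoc (α := fun _ => 𝒮) s x) =
      pathPmf n μ π s * π (s (Fin.last n)) x := by
  have h0 : Fin.snoc (α := fun _ => 𝒮) s x 0 = s 0 :=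
    Fin.snoc_castSucc (α := fun _ => 𝒮) x s 0
  unfold pathPmf
  rw [Fin.prod_univ_castSucc, h0, mul_assoc]
  simp only [← Fin.castSucc_succ, Fin.succ_last, Fin.snoc_castSucc, Fin.snoc_last]

theorem sum_snoc {𝒮 : Type} [Fintype 𝒮] (n : ℕ) (f : (Fin (n + 1) → 𝒮) → ℝ) :
    ∑ s, f s = ∑ s : Fin n → 𝒮, ∑ x, f (Fin.snoc (α := fun _ => 𝒮) s x) := by
  rw [← (Fin.snocEquiv fun _ => 𝒮).sum_comp, Fintype.sum_prod_type_right]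
  rfl

theorem sum_fin_one {𝒮 : Type} [Fintype 𝒮] (f : (Fin 1 → 𝒮) → ℝ) :
    ∑ s, f s = ∑ x, f fun _ => x :=
  ((Equiv.funUnique (Fin 1) 𝒮).symm.sum_comp f).symm

/-- The law of the last state of a trajectory with `n` transitions is `μ π ^ n`. -/
theorem sum_pathPmf_mul_last {𝒮 : Type} [Fintype 𝒮] [DecidableEq 𝒮] (μ : 𝒮 → ℝ)
    (π : 𝒮 → 𝒮 → ℝ) (n : ℕ) (g : 𝒮 → ℝ) :
    ∑ s, pathPmf n μ π s * g (s (Fin.last n)) =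
      ∑ r, ∑ s, μ r * ((Matrix.of π : Matrix 𝒮 𝒮 ℝ) ^ n) r s * g s := by
  induction n generalizing g with
  | zero =>
    rw [sum_fin_one]
    simp [pathPmf, Matrix.one_apply]
  | succ n ih =>
    rw [sum_snoc]
    simp only [pathPmf_snoc, Fin.snoc_last, mul_assoc, ← Finset.mul_sum]
    rw [ih fun r => ∑ x, π r x * g x]
    refine Finset.sum_congr rfl fun r _ => ?_
    simp only [pow_succ, Matrix.mul_apply, Matrix.of_apply, Finset.mul_sum, Finset.sum_mul]
    rw [Finset.sum_comm]
    simp only [mul_assoc]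

theorem sum_pathPmf_mul_log {𝒮 : Type} [Fintype 𝒮] [DecidableEq 𝒮]
    {μ1 μ0 : 𝒮 → ℝ} {π1 π0 : 𝒮 → 𝒮 → ℝ}
    (hμ1 : ∀ s, 0 < μ1 s) (hμ0 : ∀ s, 0 < μ0 s)
    (hπ1 : ∀ r s, 0 < π1 r s) (hπ1sum : ∀ r, ∑ s, π1 r s = 1)
    (hπ0 : ∀ r s, 0 < π0 r s) (n : ℕ) :
    ∑ s, pathPmf n μ1 π1 s * Real.log (pathPmf n μ1 π1 s / pathPmf n μ0 π0 s) =
      Dmu μ1 μ0 +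
        ∑ i ∈ Finset.range n,
          ∑ r : 𝒮, ∑ s : 𝒮,
            μ1 r * ((Matrix.of π1 : Matrix 𝒮 𝒮 ℝ) ^ i) r s * Dpi π1 π0 s := by
  induction n with
  | zero =>
    rw [sum_fin_one]
    simp [pathPmf, Dmu]
  | succ n ih =>
    rw [Finset.sum_range_succ, ← add_assoc, ← ih, ← sum_pathPmf_mul_last,
      ← Finset.sum_add_distrib, sum_snoc]
    refine Finset.sum_congr rfl fun s _ => ?_
    have hlog (x : 𝒮) :
        Real.log (pathPmf n μ1 π1 s * π1 (s (Fin.last n)) x /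
          (pathPmf n μ0 π0 s * π0 (s (Fin.last n)) x)) =
        Real.log (pathPmf n μ1 π1 s / pathPmf n μ0 π0 s) +
          Real.log (π1 (s (Fin.last n)) x / π0 (s (Fin.last n)) x) := by
      rw [mul_div_mul_comm, Real.log_mul
        (div_pos (pathPmf_pos n hμ1 hπ1 s) (pathPmf_pos n hμ0 hπ0 s)).ne'
        (div_pos (hπ1 _ _) (hπ0 _ _)).ne']
    simp only [pathPmf_snoc, hlog, mul_add, Finset.sum_add_distrib]
    rw [← Finset.sum_mul, ← Finset.mul_sum, hπ1sum, mul_one]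
    simp only [Dpi, Finset.mul_sum, mul_assoc]

end MC

open MC in
theorem markov_chain_kld_closed_form
    (𝒮 : Type) [Fintype 𝒮] [Nonempty 𝒮] [DecidableEq 𝒮]
    (N : ℕ) (hN : 2 ≤ N)
    (μ1 μ0 : 𝒮 → ℝ) (π1 π0 : 𝒮 → 𝒮 → ℝ)
    (hμ1pos : ∀ s, 0 < μ1 s) (hμ1sum : ∑ s, μ1 s = 1)
    (hμ0pos : ∀ s, 0 < μ0 s) (hμ0sum : ∑ s, μ0 s = 1)
    (hπ1pos : ∀ r s, 0 < π1 r s) (hπ1sum : ∀ r, ∑ s, π1 r s = 1)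
    (hπ0pos : ∀ r s, 0 < π0 r s) (hπ0sum : ∀ r, ∑ s, π0 r s = 1) :
    KLD N hN μ1 μ0 π1 π0 =
      Dmu μ1 μ0 +
        ∑ i ∈ Finset.range (N - 1),
          ∑ r : 𝒮, ∑ s : 𝒮,
            μ1 r * ((Matrix.of π1 : Matrix 𝒮 𝒮 ℝ) ^ i) r s * Dpi π1 π0 s := by
  obtain ⟨n, rfl⟩ : ∃ n, N = n + 1 := ⟨N - 1, by omega⟩
  simp only [KLD, pmf_eq_pathPmf, Nat.add_sub_cancel]
  exact sum_pathPmf_mul_log hμ1pos hμ0pos hπ1pos hπ1sum hπ0pos n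
end

section
/- Let π be a d×d real matrix diagonalizable as π = P·D·P⁻¹, where P is invertible, D is diagonal with D₀₀ = 1 and |D_jj| < 1 for all j ≠ 0. Let v₁ be column 0 of P, let π̃ = P·D̃·P⁻¹ where D̃ equals D except D̃₀₀ = 0, and for a vector k ∈ ℝ^d set k₁ = (P⁻¹k)₀ and k̃ = k - k₁·v₁. Then for every integer N ≥ 2: Σ_{i=0}^{N-2} π^i·k = (N-1)·k₁·v₁ + (I - π̃^{N-1})·(I - π̃)⁻¹·k̃. -/
/-!
STATEMENT 18: Closed form for `Σ_{i=0}^{N-2} π^i·k` for a diagonalizable matrix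
`π = P·D·P⁻¹` with `D₀₀ = 1` and `|D_jj| < 1` for `j ≠ 0`.
-/

/-- If `q` is idempotent and annihilates `t` on both sides, the powers of `t + q` split along
`q` and `1 - q`. -/
theorem add_idempotent_pow {R : Type*} [Ring R] {t q : R}
    (hq : q * q = q) (htq : t * q = 0) (hqt : q * t = 0) (n : ℕ) :
    (t + q) ^ n = q + t ^ n * (1 - q) := by
  induction n with
  | zero => simp
  | succ n ih =>
    have h : (1 - q) * (t + q) = t * (1 - q) := by
      simp only [sub_mul, mul_add, mul_sub, one_mul, mul_one, hq, htq, hqt]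
      abel
    rw [pow_succ, ih, add_mul, mul_assoc, h, mul_add, hq, hqt, zero_add, ← mul_assoc, ← pow_succ]

theorem sum_range_add_idempotent_pow {R : Type*} [Ring R] {t q : R}
    (hq : q * q = q) (htq : t * q = 0) (hqt : q * t = 0) (n : ℕ) :
    ∑ i ∈ Finset.range n, (t + q) ^ i = n • q + (∑ i ∈ Finset.range n, t ^ i) * (1 - q) := by
  simp only [add_idempotent_pow hq htq hqt, Finset.sum_add_distrib, Finset.sum_const,
    Finset.card_range, Finset.sum_mul]

theorem geometric_sum_closed_form
    (d : ℕ) (hd : 0 < d)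
    (P Dm : Matrix (Fin d) (Fin d) ℝ)
    (hP : IsUnit P.det)
    (hDdiag : ∀ i j : Fin d, i ≠ j → Dm i j = 0)
    (hD0 : Dm ⟨0, hd⟩ ⟨0, hd⟩ = 1)
    (hDlt : ∀ j : Fin d, j ≠ ⟨0, hd⟩ → |Dm j j| < 1)
    (pi : Matrix (Fin d) (Fin d) ℝ) (hpi : pi = P * Dm * P⁻¹)
    (Dt : Matrix (Fin d) (Fin d) ℝ)
    (hDt : ∀ i j : Fin d, Dt i j =
      if i = (⟨0, hd⟩ : Fin d) ∧ j = (⟨0, hd⟩ : Fin d) then 0 else Dm i j)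
    (pit : Matrix (Fin d) (Fin d) ℝ) (hpit : pit = P * Dt * P⁻¹)
    (k : Fin d → ℝ)
    (v₁ : Fin d → ℝ) (hv₁ : v₁ = fun i => P i ⟨0, hd⟩)
    (k₁ : ℝ) (hk₁ : k₁ = P⁻¹.mulVec k ⟨0, hd⟩)
    (kt : Fin d → ℝ) (hkt : kt = k - k₁ • v₁)
    (N : ℕ) (hN : 2 ≤ N) :
    ∑ i ∈ Finset.range (N - 1), (pi ^ i).mulVec k =
      ((N : ℝ) - 1) • (k₁ • v₁) +
        (((1 : Matrix (Fin d) (Fin d) ℝ) - pit ^ (N - 1)) *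
          ((1 : Matrix (Fin d) (Fin d) ℝ) - pit)⁻¹).mulVec kt := by
  set z : Fin d := ⟨0, hd⟩
  have hPP : P⁻¹ * P = 1 := Matrix.nonsing_inv_mul P hP
  have hPP' : P * P⁻¹ = 1 := Matrix.mul_nonsing_inv P hP
  have conj_mul (A B : Matrix (Fin d) (Fin d) ℝ) :
      P * A * P⁻¹ * (P * B * P⁻¹) = P * (A * B) * P⁻¹ := by
    calc P * A * P⁻¹ * (P * B * P⁻¹) = P * A * (P⁻¹ * P) * B * P⁻¹ := by
          simp only [Matrix.mul_assoc]
      _ = P * (A * B) * P⁻¹ := by rw [hPP, Matrix.mul_one, Matrix.mul_assoc P A B]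
  have hDt_diag : Dt = Matrix.diagonal (fun j => if j = z then 0 else Dm j j) := by
    ext i j
    rw [hDt, Matrix.diagonal_apply]
    by_cases hij : i = j
    · subst hij
      simp
    · simp [hij, hDdiag i j hij]
  set E : Matrix (Fin d) (Fin d) ℝ := Matrix.diagonal (Pi.single z 1) with hE
  have hD_add : Dm = Dt + E := by
    ext i j
    rw [Matrix.add_apply, hDt, hE, Matrix.diagonal_apply]
    by_cases hij : i = j
    · subst hij
      by_cases hi : i = z
      · subst hi
        simp [hD0]
      · simp [hi]
    · by_cases hi : i = z <;> simp [hij, hDdiag i j hij]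
  have hEE : E * E = E := by
    rw [hE, Matrix.diagonal_mul_diagonal]
    congr 1
    ext j
    by_cases hj : j = z <;> simp [hj]
  have hDtE : Dt * E = 0 := by
    rw [hDt_diag, hE, Matrix.diagonal_mul_diagonal, ← Matrix.diagonal_zero]
    congr 1
    ext j
    by_cases hj : j = z <;> simp [hj]
  have hEDt : E * Dt = 0 := by
    rw [hDt_diag, hE, Matrix.diagonal_mul_diagonal, ← Matrix.diagonal_zero]
    congr 1
    ext j
    by_cases hj : j = z <;> simp [hj]
  set Q := P * E * P⁻¹ with hQ
  have hQQ : Q * Q = Q := by rw [hQ, conj_mul, hEE]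
  have hpitQ : pit * Q = 0 := by rw [hpit, hQ, conj_mul, hDtE]; simp
  have hQpit : Q * pit = 0 := by rw [hpit, hQ, conj_mul, hEDt]; simp
  have hpi_add : pi = pit + Q := by
    rw [hpi, hpit, hQ, hD_add, Matrix.mul_add, Matrix.add_mul]
  have hQk : Q.mulVec k = k₁ • v₁ := by
    rw [hQ, ← Matrix.mulVec_mulVec, ← Matrix.mulVec_mulVec]
    have : E.mulVec (P⁻¹.mulVec k) = Pi.single z k₁ := by
      ext j
      rw [hE, Matrix.mulVec_diagonal, hk₁]
      by_cases hj : j = z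
      · subst hj
        simp
      · simp [hj]
    rw [this, hv₁]
    ext i
    simp [mul_comm]
  have hkt' : kt = (1 - Q).mulVec k := by
    rw [Matrix.sub_mulVec, Matrix.one_mulVec, hQk, hkt]
  have hdet : IsUnit (1 - pit).det := by
    have h : 1 - pit = P * (1 - Dt) * P⁻¹ := by
      rw [hpit, Matrix.mul_sub, Matrix.sub_mul, Matrix.mul_one, hPP']
    rw [h, Matrix.det_conj ((Matrix.isUnit_iff_isUnit_det P).2 hP), hDt_diag,
      ← Matrix.diagonal_one, Matrix.diagonal_sub, Matrix.det_diagonal, isUnit_iff_ne_zero,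
      Finset.prod_ne_zero_iff]
    intro j _
    by_cases hj : j = z
    · simp [hj]
    · have := (abs_lt.1 (hDlt j hj)).2
      simp only [hj, if_false]
      linarith
  have hgeom : (1 - pit ^ (N - 1)) * (1 - pit)⁻¹ = ∑ i ∈ Finset.range (N - 1), pit ^ i := by
    rw [← geom_sum_mul_neg, Matrix.mul_nonsing_inv_cancel_right _ _ hdet]
  have hcast : ((N - 1 : ℕ) : ℝ) = (N : ℝ) - 1 := by
    rw [Nat.cast_sub (by omega), Nat.cast_one]
  rw [hgeom, hkt', Matrix.mulVec_mulVec, ← Matrix.sum_mulVec, hpi_add,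
    sum_range_add_idempotent_pow hQQ hpitQ hQpit, Matrix.add_mulVec, ← hQk, ← hcast,
    ← Nat.cast_smul_eq_nsmul ℝ, Matrix.smul_mulVec]
end
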